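/- Let T ⊂ ℙ²(ℝ) be a set of exactly 8 points such that no 4 points of T lie on a line and no 7 points of T lie on a conic. Then the space I₃(T) of cubic forms vanishing at every point of T has dimension 2, and only finitely many members of the pencil I₃(T), up to nonzero scalar multiples, define singular cubic curves (a cubic form h is nonsingular if there is no nonzero point of ℂ³ at which h and all its first partial derivatives vanish). -/

import Mathlib

open MvPolynomial

noncomputable section

/-- The real projective plane, as lines through the origin of `ℝ³`. -/
abbrev P2 := Projectivization ℝ (Fin 3 → ℝ)

/-- A polynomial is psd if it takes only nonnegative values on `ℝ³`. -/
def Psd (g : MvPolynomial (Fin 3) ℝ) : Prop := ∀ u : Fin 3 → ℝ, 0 ≤ eval u g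

/-- A polynomial is sos if it is a finite sum of squares. -/
def Sos (g : MvPolynomial (Fin 3) ℝ) : Prop :=
  ∃ (n : ℕ) (h : Fin n → MvPolynomial (Fin 3) ℝ), g = ∑ i, (h i) ^ 2

/-- A form vanishes at a point of `ℙ²(ℝ)` if it vanishes at a representative vector. -/
def VanishAt (g : MvPolynomial (Fin 3) ℝ) (P : P2) : Prop := eval P.rep g = 0

/-- A form is singular at a point of `ℙ²(ℝ)` if it and all its first partial
derivatives vanish at a representative vector. -/
def SingAt (g : MvPolynomial (Fin 3) ℝ) (P : P2) : Prop :=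
  eval P.rep g = 0 ∧ ∀ i, eval P.rep (pderiv i g) = 0

/-- `I_d(T)`: the space of degree-`d` forms vanishing at every point of `T`. -/
def Isub (d : ℕ) (T : Set P2) : Submodule ℝ (MvPolynomial (Fin 3) ℝ) :=
  (homogeneousSubmodule (Fin 3) ℝ d) ⊓
  { carrier := {f | ∀ P ∈ T, VanishAt f P}
    zero_mem' := by intro P _; simp [VanishAt]
    add_mem' := by
      intro a b ha hb P hP
      have h1 := ha P hP; have h2 := hb P hP
      unfold VanishAt at *; simp [h1, h2]
    smul_mem' := by
      intro c f hf P hP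
      have h1 := hf P hP
      unfold VanishAt at *; simp [smul_eq_C_mul, h1] }

/-- `I_d(2T)`: the space of degree-`d` forms singular at every point of `T`. -/
def Isub2 (d : ℕ) (T : Set P2) : Submodule ℝ (MvPolynomial (Fin 3) ℝ) :=
  (homogeneousSubmodule (Fin 3) ℝ d) ⊓
  { carrier := {f | ∀ P ∈ T, SingAt f P}
    zero_mem' := by intro P _; constructor <;> simp [SingAt]
    add_mem' := by
      intro a b ha hb P hP
      obtain ⟨h1, h2⟩ := ha P hP; obtain ⟨h3, h4⟩ := hb P hP
      exact ⟨by simp [h1, h3], fun i => by simp [h2 i, h4 i]⟩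
    smul_mem' := by
      intro c f hf P hP
      obtain ⟨h1, h2⟩ := hf P hP
      refine ⟨by simp [smul_eq_C_mul, h1], fun i => ?_⟩
      have := h2 i
      simp [smul_eq_C_mul, this] }

/-- `I₃(T)²`: the span of products of two cubics vanishing on `T`. -/
def IsqCubic (T : Set P2) : Submodule ℝ (MvPolynomial (Fin 3) ℝ) :=
  Submodule.span ℝ {h | ∃ f₁ ∈ Isub 3 T, ∃ f₂ ∈ Isub 3 T, h = f₁ * f₂}

/-- No 4 points of `T` on a line, no 7 on a conic. -/
def GenPos (T : Set P2) : Prop :=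
  (∀ l : MvPolynomial (Fin 3) ℝ, l ≠ 0 → l.IsHomogeneous 1 →
    {P ∈ T | VanishAt l P}.encard ≤ 3) ∧
  (∀ c : MvPolynomial (Fin 3) ℝ, c ≠ 0 → c.IsHomogeneous 2 →
    {P ∈ T | VanishAt c P}.encard ≤ 6)

/-- The real projective zero set of `g`. -/
def VR (g : MvPolynomial (Fin 3) ℝ) : Set P2 := {P | VanishAt g P}

lemma lift_general {R A B : Type} [CommRing R] [CommRing A] [CommRing B] [Algebra R A]
    [Algebra.FormallySmooth R A] (φ : R →+* B) (g : B →+* A) (hg : Function.Surjective g)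
    (hker : ∀ x y, g x = 0 → g y = 0 → x * y = 0)
    (hcomp : g.comp φ = algebraMap R A) :
    ∃ σ : A →+* B, (∀ a, g (σ a) = a) ∧ ∀ r, σ (algebraMap R A r) = φ r := by
  let _ := φ.toAlgebra
  have hcm : ∀ r : R, g (algebraMap R B r) = algebraMap R A r := fun r => by
    rw [← hcomp]; rfl
  let g' : B →ₐ[R] A := { g with commutes' := hcm }
  have hn : IsNilpotent (RingHom.ker (g' : B →+* A)) := by
    refine ⟨2, ?_⟩
    rw [pow_two, Ideal.zero_eq_bot, eq_bot_iff, Ideal.mul_le]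
    intro x hx y hy
    simpa using hker x y hx hy
  let s := Algebra.FormallySmooth.liftOfSurjective (AlgHom.id R A) g' hg hn
  refine ⟨s.toRingHom, fun a => ?_, fun r => ?_⟩
  · exact Algebra.FormallySmooth.liftOfSurjective_apply (AlgHom.id R A) g' hg hn a
  · exact s.commutes r

lemma fsmooth_field {F K : Type} [Field F] [Field K] [CharZero F] [Algebra F K] :
    Algebra.FormallySmooth F K := by
  obtain ⟨s, hs⟩ := exists_isTranscendenceBasis F K
  have := hs.isAlgebraic_field
  have : Algebra.IsSeparable (IntermediateField.adjoin F (Set.range ((↑) : s → K))) K := by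
    infer_instance
  exact .of_algebraicIndependent_of_isSeparable hs.1

lemma fsmooth_poly {K : Type} [Field K] [Algebra (Polynomial ℂ) K]
    (hinj : Function.Injective (algebraMap (Polynomial ℂ) K)) :
    Algebra.FormallySmooth (Polynomial ℂ) K := by
  have : FaithfulSMul (Polynomial ℂ) K := (faithfulSMul_iff_algebraMap_injective _ _).2 hinj
  let : Algebra (FractionRing (Polynomial ℂ)) K := FractionRing.liftAlgebra _ _
  have : IsScalarTower (Polynomial ℂ) (FractionRing (Polynomial ℂ)) K :=
    FractionRing.isScalarTower_liftAlgebra _ _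
  have h1 : Algebra.FormallySmooth (Polynomial ℂ) (FractionRing (Polynomial ℂ)) :=
    .of_isLocalization (nonZeroDivisors _)
  have : CharZero (FractionRing (Polynomial ℂ)) := inferInstance
  have h2 : Algebra.FormallySmooth (FractionRing (Polynomial ℂ)) K := fsmooth_field
  exact .comp _ (FractionRing (Polynomial ℂ)) _

/-- A derivation with `D t = 1`, `D = 0` on constants. -/
lemma exists_deriv {K : Type} [Field K] (ι : ℂ →+* K) (t : K)
    (ht : ∀ p : Polynomial ℂ, p.eval₂ ι t = 0 → p = 0) :
    ∃ D : K → K, (∀ x y, D (x + y) = D x + D y) ∧ (∀ x y, D (x * y) = x * D y + D x * y) ∧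
      (∀ c, D (ι c) = 0) ∧ D t = 1 := by
  let : Algebra (Polynomial ℂ) K := (Polynomial.eval₂RingHom ι t).toAlgebra
  have hmap : ∀ p : Polynomial ℂ, algebraMap (Polynomial ℂ) K p = p.eval₂ ι t := fun p => rfl
  have hs : Algebra.FormallySmooth (Polynomial ℂ) K := fsmooth_poly (by
    rw [injective_iff_map_eq_zero]; exact ht)
  let φ : Polynomial ℂ →+* DualNumber K :=
    Polynomial.eval₂RingHom ((TrivSqZeroExt.inlHom K K).comp ι)
      (TrivSqZeroExt.inl t + DualNumber.eps)
  let g : DualNumber K →+* K := (TrivSqZeroExt.fstHom K K K).toRingHom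
  have hg : ∀ x, g x = TrivSqZeroExt.fst x := fun x => rfl
  obtain ⟨σ, h1, h2⟩ := lift_general φ g (fun x => ⟨TrivSqZeroExt.inl x, by simp [hg]⟩)
    (fun x y hx hy => by
      rw [hg] at hx hy
      ext <;> simp [hx, hy])
    (by
      apply Polynomial.ringHom_ext
      · intro a
        simp [φ, hg, hmap]
      · simp [φ, hg, hmap])
  refine ⟨fun x => TrivSqZeroExt.snd (σ x), fun x y => by simp, fun x y => ?_, fun c => ?_, ?_⟩
  · have hx := h1 x
    have hy := h1 y
    rw [hg] at hx hy
    simp [hx, hy]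
  · have := h2 (Polynomial.C c)
    simp only [hmap, Polynomial.eval₂_C] at this
    beta_reduce; rw [this]; simp [φ]
  · have := h2 Polynomial.X
    simp only [hmap, Polynomial.eval₂_X] at this
    beta_reduce; rw [this]; simp [φ]

lemma deriv_eval {K : Type} [Field K] (ι : ℂ →+* K) (D : K → K)
    (hadd : ∀ x y, D (x + y) = D x + D y) (hmul : ∀ x y, D (x * y) = x * D y + D x * y)
    (hc : ∀ c, D (ι c) = 0) (u : Fin 3 → K) (p : MvPolynomial (Fin 3) ℂ) :
    D (eval₂ ι u p) = ∑ i, eval₂ ι u (pderiv i p) * D (u i) := by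
  induction p using MvPolynomial.induction_on with
  | C a => simp [hc]
  | add p q hp hq => simp [hadd, hp, hq, add_mul, Finset.sum_add_distrib]
  | mul_X p j hp =>
    simp only [eval₂_mul, eval₂_X, hmul, hp, Derivation.leibniz, pderiv_X, smul_eq_mul, eval₂_add]
    simp only [Fin.sum_univ_three]
    fin_cases j <;> simp <;> ring

lemma bertini (f g : MvPolynomial (Fin 3) ℂ) :
    {t : ℂ | ∃ u : Fin 3 → ℂ, eval u (f + C t * g) = 0 ∧
      (∀ i, eval u (pderiv i (f + C t * g)) = 0) ∧ eval u g ≠ 0}.Finite := by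
  by_contra hinf
  have hinf : Set.Infinite _ := hinf
  let e := hinf.natEmbedding
  have he : ∀ n, ∃ u : Fin 3 → ℂ, eval u (f + C (e n : ℂ) * g) = 0 ∧
      (∀ i, eval u (pderiv i (f + C (e n : ℂ) * g)) = 0) ∧ eval u g ≠ 0 := fun n => (e n).2
  choose u hu1 hu2 hu3 using he
  let K := Filter.Germ (Filter.hyperfilter ℕ : Filter ℕ) ℂ
  let : Field K := Filter.Germ.instField
  let π : (ℕ → ℂ) →+* K := Filter.Germ.coeRingHom _
  have hπ : ∀ x y : ℕ → ℂ, π x = π y ↔ ∀ᶠ n in (Filter.hyperfilter ℕ : Filter ℕ), x n = y n :=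
    fun x y => Filter.Germ.coe_eq
  let ι : ℂ →+* K := π.comp (Pi.constRingHom ℕ ℂ)
  let t : K := π (fun n => (e n : ℂ))
  let U : Fin 3 → K := fun i => π (fun n => u n i)
  have hev : ∀ p : MvPolynomial (Fin 3) ℂ, eval₂ ι U p = π (fun n => eval (u n) p) := by
    intro p
    induction p using MvPolynomial.induction_on with
    | C a => simp [ι]; rfl
    | add p q hp hq => 
      rw [eval₂_add, hp, hq, ← map_add]; congr 1; funext n; simp
    | mul_X p j hp =>
      rw [eval₂_mul, eval₂_X, hp, ← map_mul]; congr 1; funext n; simp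
  have ht : ∀ p : Polynomial ℂ, p.eval₂ ι t = 0 → p = 0 := by
    intro p hp
    have h1 : p.eval₂ ι t = π (fun n => p.eval (e n : ℂ)) := by
      clear hp
      induction p using Polynomial.induction_on' with
      | add p q hp hq => simp only [Polynomial.eval₂_add, hp, hq, ← map_add, Polynomial.eval_add]; rfl
      | monomial k a =>
        simp only [Polynomial.eval₂_monomial, Polynomial.eval_monomial, t, ι, RingHom.comp_apply,
          ← map_pow, ← map_mul]; rfl
    rw [h1, ← map_zero π, hπ] at hp
    by_contra hp0
    have hfin : {n : ℕ | p.eval (e n : ℂ) = 0}.Finite := by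
      have : {n : ℕ | p.eval (e n : ℂ) = 0} ⊆ (fun n => (e n : ℂ)) ⁻¹' (p.roots.toFinset : Set ℂ) := by
        intro n hn
        simpa [hp0] using hn
      refine Set.Finite.subset (Set.Finite.preimage ?_ (Finset.finite_toSet _)) this
      intro a _ b _ hab
      exact e.injective (Subtype.ext hab)
    have := Filter.notMem_hyperfilter_of_finite hfin
    exact this hp
  obtain ⟨D, hadd, hmul, hc, hDt⟩ := exists_deriv ι t ht
  have e1 : eval₂ ι U f + t * eval₂ ι U g = 0 := by
    rw [hev, hev, ← map_mul, ← map_add, ← map_zero π, hπ]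
    refine Filter.Eventually.of_forall fun n => ?_
    simpa using hu1 n
  have e2 : ∀ i, eval₂ ι U (pderiv i f) + t * eval₂ ι U (pderiv i g) = 0 := by
    intro i
    rw [hev, hev, ← map_mul, ← map_add, ← map_zero π, hπ]
    refine Filter.Eventually.of_forall fun n => ?_
    simpa using hu2 n i
  have hD0 : D 0 = 0 := by simpa using hc 0
  have e3 : D (eval₂ ι U f + t * eval₂ ι U g) = 0 := by rw [e1, hD0]
  rw [hadd, hmul, hDt, deriv_eval ι D hadd hmul hc, deriv_eval ι D hadd hmul hc] at e3
  have e4 : eval₂ ι U g = 0 := by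
    rw [← e3, Finset.mul_sum, ← add_assoc, ← Finset.sum_add_distrib]
    rw [Finset.sum_eq_zero]
    · simp
    · intro i _
      linear_combination (D (U i)) * e2 i
  rw [hev, ← map_zero π, hπ] at e4
  obtain ⟨n, hn⟩ := e4.exists
  exact hu3 n hn

/-- Linear form with coefficient vector `n`. -/
def lin (n : Fin 3 → ℝ) : MvPolynomial (Fin 3) ℝ := C (n 0) * X 0 + C (n 1) * X 1 + C (n 2) * X 2

/-- Cross product. -/
def cr (a b : Fin 3 → ℝ) : Fin 3 → ℝ :=
  ![a 1 * b 2 - a 2 * b 1, a 2 * b 0 - a 0 * b 2, a 0 * b 1 - a 1 * b 0]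

@[simp] lemma cr0 (a b : Fin 3 → ℝ) : cr a b 0 = a 1 * b 2 - a 2 * b 1 := rfl
@[simp] lemma cr1 (a b : Fin 3 → ℝ) : cr a b 1 = a 2 * b 0 - a 0 * b 2 := rfl
@[simp] lemma cr2 (a b : Fin 3 → ℝ) : cr a b 2 = a 0 * b 1 - a 1 * b 0 := rfl

lemma eval_lin (n x : Fin 3 → ℝ) : eval x (lin n) = n 0 * x 0 + n 1 * x 1 + n 2 * x 2 := by
  simp [lin]

lemma lin_hom (n : Fin 3 → ℝ) : (lin n).IsHomogeneous 1 :=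
  ((isHomogeneous_C_mul_X _ _).add (isHomogeneous_C_mul_X _ _)).add (isHomogeneous_C_mul_X _ _)

lemma lin_ne {n : Fin 3 → ℝ} (hn : n ≠ 0) : lin n ≠ 0 := by
  intro h
  apply hn
  funext i
  have h2 := congrArg (eval (Pi.single i 1)) h
  rw [eval_lin] at h2
  fin_cases i <;> simpa using h2

lemma ne_of_lin {n : Fin 3 → ℝ} (hn : lin n ≠ 0) : n ≠ 0 := by
  rintro rfl
  simp [lin] at hn

lemma cr_ne_iff (a b : Fin 3 → ℝ) : cr a b ≠ 0 ↔ (cr a b 0 ≠ 0 ∨ cr a b 1 ≠ 0 ∨ cr a b 2 ≠ 0) := by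
  constructor
  · intro h
    by_contra! h2
    apply h
    funext i
    fin_cases i
    exacts [h2.1, h2.2.1, h2.2.2]
  · rintro h h2
    simp only [h2] at h
    simp at h

lemma span_of_perp {a b : Fin 3 → ℝ} (hab : cr a b ≠ 0) {x : Fin 3 → ℝ}
    (hx : eval x (lin (cr a b)) = 0) : ∃ α β : ℝ, x = α • a + β • b := by
  rw [eval_lin] at hx
  rw [cr_ne_iff] at hab
  simp only [cr0, cr1, cr2] at hx hab
  rcases hab with h | h | h
  · refine ⟨(x 1 * b 2 - x 2 * b 1) / (a 1 * b 2 - a 2 * b 1),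
      (a 1 * x 2 - a 2 * x 1) / (a 1 * b 2 - a 2 * b 1), ?_⟩
    funext i
    fin_cases i <;> simp <;> rw [div_mul_eq_mul_div, div_mul_eq_mul_div, ← add_div, eq_div_iff h] <;>
      first | ring1 | linear_combination hx | linear_combination -hx
  · refine ⟨(x 2 * b 0 - x 0 * b 2) / (a 2 * b 0 - a 0 * b 2),
      (a 2 * x 0 - a 0 * x 2) / (a 2 * b 0 - a 0 * b 2), ?_⟩
    funext i
    fin_cases i <;> simp <;> rw [div_mul_eq_mul_div, div_mul_eq_mul_div, ← add_div, eq_div_iff h] <;>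
      first | ring1 | linear_combination hx | linear_combination -hx
  · refine ⟨(x 0 * b 1 - x 1 * b 0) / (a 0 * b 1 - a 1 * b 0),
      (a 0 * x 1 - a 1 * x 0) / (a 0 * b 1 - a 1 * b 0), ?_⟩
    funext i
    fin_cases i <;> simp <;> rw [div_mul_eq_mul_div, div_mul_eq_mul_div, ← add_div, eq_div_iff h] <;>
      first | ring1 | linear_combination hx | linear_combination -hx

lemma perp_span (a b : Fin 3 → ℝ) (x y : ℝ) : eval (x • a + y • b) (lin (cr a b)) = 0 := by
  rw [eval_lin]; simp; ring

/-- two vectors on both planes are proportional: a form vanishing at `d,e`. -/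
lemma lin_prop {d e m : Fin 3 → ℝ} (hde : cr d e ≠ 0) (h1 : eval d (lin m) = 0)
    (h2 : eval e (lin m) = 0) : ∃ c : ℝ, m = c • cr d e := by
  rw [eval_lin] at h1 h2
  rw [cr_ne_iff] at hde
  simp only [cr0, cr1, cr2] at hde
  rcases hde with h | h | h
  · refine ⟨m 0 / (d 1 * e 2 - d 2 * e 1), ?_⟩
    funext i
    fin_cases i <;> simp <;> field_simp
    · linear_combination e 2 * h1 - d 2 * h2
    · linear_combination d 1 * h2 - e 1 * h1
  · refine ⟨m 1 / (d 2 * e 0 - d 0 * e 2), ?_⟩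
    funext i
    fin_cases i <;> simp <;> field_simp
    · linear_combination d 2 * h2 - e 2 * h1
    · linear_combination e 0 * h1 - d 0 * h2
  · refine ⟨m 2 / (d 0 * e 1 - d 1 * e 0), ?_⟩
    funext i
    fin_cases i <;> simp <;> field_simp
    · linear_combination e 1 * h1 - d 1 * h2
    · linear_combination d 0 * h2 - e 0 * h1

lemma eval_bind (s : Fin 3 → MvPolynomial (Fin 3) ℝ) (p : MvPolynomial (Fin 3) ℝ)
    (x : Fin 3 → ℝ) : eval x (bind₁ s p) = eval (fun i => eval x (s i)) p := by
  induction p using MvPolynomial.induction_on with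
  | C a => simp
  | add p q hp hq => simp [hp, hq]
  | mul_X p j hp => simp [hp]

lemma sum_mono {d : ℕ} {p : MvPolynomial (Fin 3) ℝ} (hp : p.IsHomogeneous d)
    (Q : MvPolynomial (Fin 3) ℝ → Prop) (h0 : Q 0) (hadd : ∀ a b, Q a → Q b → Q (a + b))
    (hm : ∀ (a : ℝ) (i j k : ℕ), i + j + k = d → Q (C a * X 0 ^ i * X 1 ^ j * X 2 ^ k)) : Q p := by
  rw [← support_sum_monomial_coeff p]
  refine Finset.sum_induction _ Q hadd h0 ?_
  intro m hmem
  have hdeg := hp.degree_eq_sum_deg_support hmem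
  rw [monomial_eq, Finsupp.prod_fintype _ _ (by simp)]
  have := hm (coeff m p) (m 0) (m 1) (m 2) (by
    rw [hdeg, ← Fin.sum_univ_three]
    exact (Finset.sum_subset (Finset.subset_univ _) (by simp)).symm)
  simpa [Fin.prod_univ_three, mul_assoc] using this

lemma coefs1 {p : MvPolynomial (Fin 3) ℝ} (hp : p.IsHomogeneous 1) : ∃ n, p = lin n := by
  refine sum_mono hp (fun p => ∃ n, p = lin n) ⟨0, by simp [lin]⟩ ?_ ?_
  · rintro _ _ ⟨n, rfl⟩ ⟨m, rfl⟩
    exact ⟨n + m, by simp [lin]; ring⟩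
  · intro a i j k h
    have hi : i ≤ 1 := by omega
    have hj : j ≤ 1 := by omega
    interval_cases i <;> interval_cases j
    · exact ⟨![0, 0, a], by obtain rfl : k = 1 := by omega
                            simp [lin]⟩
    · exact ⟨![0, a, 0], by obtain rfl : k = 0 := by omega
                            simp [lin]⟩
    · exact ⟨![a, 0, 0], by obtain rfl : k = 0 := by omega
                            simp [lin]⟩
    · omega

/-- General quadratic form. -/
def quad (c : Fin 6 → ℝ) : MvPolynomial (Fin 3) ℝ :=
  C (c 0) * X 0 ^ 2 + C (c 1) * X 1 ^ 2 + C (c 2) * X 2 ^ 2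
  + C (c 3) * (X 0 * X 1) + C (c 4) * (X 0 * X 2) + C (c 5) * (X 1 * X 2)

/-- General cubic form. -/
def cub (c : Fin 10 → ℝ) : MvPolynomial (Fin 3) ℝ :=
  C (c 0) * X 0 ^ 3 + C (c 1) * (X 0 ^ 2 * X 1) + C (c 2) * (X 0 ^ 2 * X 2)
  + C (c 3) * (X 0 * X 1 ^ 2) + C (c 4) * (X 0 * X 1 * X 2) + C (c 5) * (X 0 * X 2 ^ 2)
  + C (c 6) * X 1 ^ 3 + C (c 7) * (X 1 ^ 2 * X 2) + C (c 8) * (X 1 * X 2 ^ 2) + C (c 9) * X 2 ^ 3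

lemma coefs2 {p : MvPolynomial (Fin 3) ℝ} (hp : p.IsHomogeneous 2) : ∃ c, p = quad c := by
  refine sum_mono hp (fun p => ∃ n, p = quad n) ⟨0, by simp [quad]⟩ ?_ ?_
  · rintro _ _ ⟨n, rfl⟩ ⟨m, rfl⟩
    exact ⟨n + m, by simp [quad]; ring⟩
  · intro a i j k h
    have hi : i ≤ 2 := by omega
    have hj : j ≤ 2 := by omega
    obtain rfl : k = 2 - i - j := by omega
    interval_cases i <;> interval_cases j <;> try omega
    · exact ⟨![0, 0, a, 0, 0, 0], by simp [quad]⟩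
    · exact ⟨![0, 0, 0, 0, 0, a], by simp [quad]; ring⟩
    · exact ⟨![0, a, 0, 0, 0, 0], by simp [quad]⟩
    · exact ⟨![0, 0, 0, 0, a, 0], by simp [quad]; ring⟩
    · exact ⟨![0, 0, 0, a, 0, 0], by simp [quad]; ring⟩
    · exact ⟨![a, 0, 0, 0, 0, 0], by simp [quad]⟩

lemma coefs3 {p : MvPolynomial (Fin 3) ℝ} (hp : p.IsHomogeneous 3) : ∃ c, p = cub c := by
  refine sum_mono hp (fun p => ∃ n, p = cub n) ⟨0, by simp [cub]⟩ ?_ ?_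
  · rintro _ _ ⟨n, rfl⟩ ⟨m, rfl⟩
    exact ⟨n + m, by simp [cub]; ring⟩
  · intro a i j k h
    have hi : i ≤ 3 := by omega
    have hj : j ≤ 3 := by omega
    obtain rfl : k = 3 - i - j := by omega
    interval_cases i <;> interval_cases j <;> try omega
    · exact ⟨![0, 0, 0, 0, 0, 0, 0, 0, 0, a], by simp [cub]⟩
    · exact ⟨![0, 0, 0, 0, 0, 0, 0, 0, a, 0], by simp [cub]; ring⟩
    · exact ⟨![0, 0, 0, 0, 0, 0, 0, a, 0, 0], by simp [cub]; ring⟩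
    · exact ⟨![0, 0, 0, 0, 0, 0, a, 0, 0, 0], by simp [cub]⟩
    · exact ⟨![0, 0, 0, 0, 0, a, 0, 0, 0, 0], by simp [cub]; ring⟩
    · exact ⟨![0, 0, 0, 0, a, 0, 0, 0, 0, 0], by simp [cub]; ring⟩
    · exact ⟨![0, 0, 0, a, 0, 0, 0, 0, 0, 0], by simp [cub]; ring⟩
    · exact ⟨![0, 0, a, 0, 0, 0, 0, 0, 0, 0], by simp [cub]; ring⟩
    · exact ⟨![0, a, 0, 0, 0, 0, 0, 0, 0, 0], by simp [cub]; ring⟩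
    · exact ⟨![a, 0, 0, 0, 0, 0, 0, 0, 0, 0], by simp [cub]⟩

lemma quad_line {p : MvPolynomial (Fin 3) ℝ} (hp : p.IsHomogeneous 2) (a b : Fin 3 → ℝ) (x y : ℝ) :
    eval (x • a + y • b) p = eval a p * x ^ 2 + (eval (a + b) p - eval a p - eval b p) * (x * y)
      + eval b p * y ^ 2 := by
  obtain ⟨c, rfl⟩ := coefs2 hp
  simp [quad]; ring

lemma cub_line {p : MvPolynomial (Fin 3) ℝ} (hp : p.IsHomogeneous 3) (a b : Fin 3 → ℝ) (x y : ℝ) :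
    eval (x • a + y • b) p = eval a p * x ^ 3
      + ((eval (a + b) p - eval (a - b) p) / 2 - eval b p) * (x ^ 2 * y)
      + ((eval (a + b) p + eval (a - b) p) / 2 - eval a p) * (x * y ^ 2)
      + eval b p * y ^ 3 := by
  obtain ⟨c, rfl⟩ := coefs3 hp
  simp [cub]; ring

lemma cub_grad {p : MvPolynomial (Fin 3) ℝ} (hp : p.IsHomogeneous 3) (a b : Fin 3 → ℝ) :
    (eval (a + b) p - eval (a - b) p) / 2 - eval b p = b 0 * eval a (pderiv 0 p)
      + b 1 * eval a (pderiv 1 p) + b 2 * eval a (pderiv 2 p) := by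
  obtain ⟨c, rfl⟩ := coefs3 hp
  simp [cub, pderiv_X]; ring

lemma hom_div {d : ℕ} {p l q : MvPolynomial (Fin 3) ℝ} (hp : p.IsHomogeneous (1 + d))
    (hl : l.IsHomogeneous 1) (h : p = l * q) :
    ∃ q', q'.IsHomogeneous d ∧ p = l * q' := by
  letI : GradedAlgebra (homogeneousSubmodule (Fin 3) ℝ) := MvPolynomial.gradedAlgebra
  refine ⟨homogeneousComponent d q, homogeneousComponent_isHomogeneous _ _, ?_⟩
  have h1 := DirectSum.coe_decompose_mul_add_of_left_mem (homogeneousSubmodule (Fin 3) ℝ)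
    (i := 1) (j := d) (b := q) ((mem_homogeneousSubmodule _ _).2 hl)
  rw [← h] at h1
  have h2 : ∀ (r : MvPolynomial (Fin 3) ℝ) i,
      ((DirectSum.decompose (homogeneousSubmodule (Fin 3) ℝ) r) i : MvPolynomial (Fin 3) ℝ) =
      homogeneousComponent i r := fun r i => decomposition.decompose'_apply r i
  rw [h2, h2, homogeneousComponent_eq_self hp] at h1
  exact h1

lemma div_line {d : ℕ} {p : MvPolynomial (Fin 3) ℝ} (hp : p.IsHomogeneous (1 + d))
    {n : Fin 3 → ℝ} (hn : n ≠ 0) (hv : ∀ x, eval x (lin n) = 0 → eval x p = 0) :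
    ∃ q, q.IsHomogeneous d ∧ p = lin n * q := by
  obtain ⟨k, hk⟩ := Function.ne_iff.1 hn
  have hk : n k ≠ 0 := hk
  let s : Fin 3 → MvPolynomial (Fin 3) ℝ := fun j => X j - C ((Pi.single k (1 / n k) : Fin 3 → ℝ) j) * lin n
  have hs : bind₁ s p = 0 := by
    apply MvPolynomial.funext
    intro x
    rw [map_zero, eval_bind]
    apply hv
    rw [eval_lin]
    simp only [s, map_sub, eval_X, map_mul, eval_C, eval_lin]
    fin_cases k <;> simp at hk ⊢ <;> field_simp <;> ring
  have hdvd : lin n ∣ p := by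
    rw [← Ideal.mem_span_singleton, ← Ideal.Quotient.eq_zero_iff_mem]
    have h1 : ∀ q, Ideal.Quotient.mk (Ideal.span {lin n}) (bind₁ s q) =
        Ideal.Quotient.mk (Ideal.span {lin n}) q := by
      intro q
      induction q using MvPolynomial.induction_on with
      | C a => simp
      | add p q hp hq => simp [hp, hq]
      | mul_X p j hp =>
        rw [map_mul, map_mul, hp, map_mul, bind₁_X_right]
        congr 1
        rw [Ideal.Quotient.eq, Ideal.mem_span_singleton]
        exact ⟨-C ((Pi.single k (1 / n k) : Fin 3 → ℝ) j), by simp only [s]; ring⟩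
    rw [← h1, hs, map_zero]
  obtain ⟨q, hq⟩ := hdvd
  exact hom_div hp (lin_hom n) hq

lemma cub_sub {p : MvPolynomial (Fin 3) ℝ} (hp : p.IsHomogeneous 3) (u v w : Fin 3 → ℝ) :
    ∃ c : Fin 10 → ℝ, ∀ x y z : ℝ, eval (x • u + y • v + z • w) p =
      c 0 * x ^ 3 + c 1 * (x ^ 2 * y) + c 2 * (x ^ 2 * z)
  + c 3 * (x * y ^ 2) + c 4 * (x * y * z) + c 5 * (x * z ^ 2)
  + c 6 * y ^ 3 + c 7 * (y ^ 2 * z) + c 8 * (y * z ^ 2) + c 9 * z ^ 3 := by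
  let s : Fin 3 → MvPolynomial (Fin 3) ℝ := fun i => lin ![u i, v i, w i]
  have h1 : (bind₁ s p).IsHomogeneous 3 := by
    have := hp.aeval s (n := 1) (fun i => lin_hom _)
    simpa using this
  obtain ⟨c, hc⟩ := coefs3 h1
  refine ⟨c, fun x y z => ?_⟩
  have h2 := congrArg (eval ![x, y, z]) hc
  rw [eval_bind] at h2
  have h3 : (fun i => eval ![x, y, z] (s i)) = x • u + y • v + z • w := by
    funext i
    simp [s, eval_lin]; ring
  rw [h3] at h2
  rw [h2]
  simp [cub]

/-- The configuration: eight points, no 4 on a line, no 7 on a conic. -/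
structure Conf (P : Fin 8 → Fin 3 → ℝ) : Prop where
  ind : ∀ i j, i ≠ j → cr (P i) (P j) ≠ 0
  line : ∀ n, n ≠ 0 → (Finset.univ.filter (fun i => eval (P i) (lin n) = 0)).card ≤ 3
  conic : ∀ c : MvPolynomial (Fin 3) ℝ, c ≠ 0 → c.IsHomogeneous 2 →
    (Finset.univ.filter (fun i => eval (P i) c = 0)).card ≤ 6

lemma perp_left (a b : Fin 3 → ℝ) : eval a (lin (cr a b)) = 0 := by
  rw [eval_lin]; simp; ring

lemma perp_right (a b : Fin 3 → ℝ) : eval b (lin (cr a b)) = 0 := by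
  rw [eval_lin]; simp; ring

/-- conic vanishing at a,b, and at a third point `αa+βb` or at `a+b` contains the line -/
lemma conic_line {p : MvPolynomial (Fin 3) ℝ} (hp : p.IsHomogeneous 2) {a b : Fin 3 → ℝ}
    (hab : cr a b ≠ 0) (ha : eval a p = 0) (hb : eval b p = 0)
    {α β : ℝ} (hα : α ≠ 0) (hβ : β ≠ 0) (h : eval (α • a + β • b) p = 0) :
    ∃ m, p = lin (cr a b) * lin m := by
  rw [quad_line hp, ha, hb] at h
  have h1 : eval (a + b) p = 0 := by
    have : eval (a + b) p * (α * β) = 0 := by linear_combination h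
    simpa [hα, hβ] using this
  obtain ⟨q, hq, hpq⟩ := div_line (d := 1) (by simpa using hp) hab (fun x hx => by
    obtain ⟨s, t, rfl⟩ := span_of_perp hab hx
    rw [quad_line hp, ha, hb, h1]; ring)
  obtain ⟨m, rfl⟩ := coefs1 hq
  exact ⟨m, hpq⟩

lemma cubic_line {p : MvPolynomial (Fin 3) ℝ} (hp : p.IsHomogeneous 3) {a b : Fin 3 → ℝ}
    (hab : cr a b ≠ 0) (h : ∀ x y : ℝ, eval (x • a + y • b) p = 0) :
    ∃ q, q.IsHomogeneous 2 ∧ p = lin (cr a b) * q := by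
  refine div_line (d := 2) (by simpa using hp) hab (fun x hx => ?_)
  obtain ⟨s, t, rfl⟩ := span_of_perp hab hx
  exact h s t

/-- third point on a line -/
lemma third {a b c : Fin 3 → ℝ} (hab : cr a b ≠ 0) (hac : cr a c ≠ 0) (hbc : cr b c ≠ 0)
    (h : eval c (lin (cr a b)) = 0) : ∃ α β : ℝ, α ≠ 0 ∧ β ≠ 0 ∧ c = α • a + β • b := by
  obtain ⟨s, t, rfl⟩ := span_of_perp hab h
  refine ⟨s, t, ?_, ?_, rfl⟩
  · rintro rfl
    apply hbc
    funext i; fin_cases i <;> simp <;> ring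
  · rintro rfl
    apply hac
    funext i; fin_cases i <;> simp <;> ring

lemma five {P : Fin 8 → Fin 3 → ℝ} (hP : Conf P) (S : Finset (Fin 8)) (hS : 5 ≤ S.card)
    {c₁ c₂ : MvPolynomial (Fin 3) ℝ} (h₁ : c₁.IsHomogeneous 2) (h₂ : c₂.IsHomogeneous 2)
    (hv₁ : ∀ i ∈ S, eval (P i) c₁ = 0) (hv₂ : ∀ i ∈ S, eval (P i) c₂ = 0) (hne : c₁ ≠ 0) :
    ∃ c : ℝ, c₂ = C c * c₁ := by
  by_cases hcol : ∃ i ∈ S, ∃ j ∈ S, ∃ k ∈ S, i ≠ j ∧ i ≠ k ∧ j ≠ k ∧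
      eval (P k) (lin (cr (P i) (P j))) = 0
  · obtain ⟨i, hi, j, hj, k, hk, hij, hik, hjk, hc⟩ := hcol
    have hn := hP.ind i j hij
    obtain ⟨α, β, hα, hβ, hPk⟩ := third hn (hP.ind i k hik) (hP.ind j k hjk) hc
    obtain ⟨m₁, hm₁⟩ := conic_line h₁ hn (hv₁ i hi) (hv₁ j hj) hα hβ (hPk ▸ hv₁ k hk)
    obtain ⟨m₂, hm₂⟩ := conic_line h₂ hn (hv₂ i hi) (hv₂ j hj) hα hβ (hPk ▸ hv₂ k hk)
    have hcard : 1 < (S \ Finset.univ.filter (fun l => eval (P l) (lin (cr (P i) (P j))) = 0)).card := by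
      have := hP.line _ hn
      have := Finset.le_card_sdiff (Finset.univ.filter (fun l => eval (P l) (lin (cr (P i) (P j))) = 0)) S
      omega
    obtain ⟨d, hd, e, he, hde⟩ := Finset.one_lt_card.1 hcard
    simp only [Finset.mem_sdiff, Finset.mem_filter, Finset.mem_univ, true_and] at hd he
    have key : ∀ m c, c = lin (cr (P i) (P j)) * lin m → (∀ i ∈ S, eval (P i) c = 0) →
        ∃ r : ℝ, m = r • cr (P d) (P e) := by
      rintro m c rfl hv
      refine lin_prop (hP.ind d e hde) ?_ ?_
      · have := hv d hd.1
        rw [map_mul] at this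
        exact (mul_eq_zero.1 this).resolve_left hd.2
      · have := hv e he.1
        rw [map_mul] at this
        exact (mul_eq_zero.1 this).resolve_left he.2
    obtain ⟨r₁, rfl⟩ := key _ _ hm₁ hv₁
    obtain ⟨r₂, rfl⟩ := key _ _ hm₂ hv₂
    have hs : ∀ (r : ℝ) n, lin (r • n) = C r * lin n := by
      intro r n; simp [lin]; ring
    rw [hs] at hm₁ hm₂
    have hr : r₁ ≠ 0 := by
      rintro rfl
      apply hne; rw [hm₁]; simp
    refine ⟨r₂ / r₁, ?_⟩
    rw [hm₂, hm₁]
    have : (C r₂ : MvPolynomial (Fin 3) ℝ) = C (r₂ / r₁) * C r₁ := by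
      rw [← C_mul, div_mul_cancel₀ _ hr]
    rw [this]; ring
  · push Not at hcol
    obtain ⟨i, hi, j, hj, hij⟩ := Finset.one_lt_card.1 (show 1 < S.card by omega)
    have hcard : 2 < (S \ {i, j}).card := by
      have := Finset.le_card_sdiff ({i, j} : Finset (Fin 8)) S
      have := Finset.card_le_two (a := i) (b := j)
      omega
    obtain ⟨c, hc, d, hd, e, he, hcd, hce, hde⟩ := Finset.two_lt_card.1 hcard
    simp only [Finset.mem_sdiff, Finset.mem_insert, Finset.mem_singleton, not_or] at hc hd he
    have hn := hP.ind i j hij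
    -- combination
    have key : ∀ q : MvPolynomial (Fin 3) ℝ, q.IsHomogeneous 2 → (∀ i ∈ S, eval (P i) q = 0) →
        eval (P i + P j) q = 0 → q = 0 := by
      intro q hq hv h
      obtain ⟨m, hm⟩ := conic_line hq hn (hv i hi) (hv j hj) one_ne_zero one_ne_zero (by simpa using h)
      have hz : ∀ k ∈ S, k ≠ i → k ≠ j → eval (P k) (lin m) = 0 := by
        intro k hk hki hkj
        have h1 := hv k hk
        rw [hm, map_mul] at h1
        exact (mul_eq_zero.1 h1).resolve_left (hcol i hi j hj k hk hij hki.symm hkj.symm)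
      obtain ⟨r, rfl⟩ := lin_prop (hP.ind c d hcd) (hz c hc.1 hc.2.1 hc.2.2) (hz d hd.1 hd.2.1 hd.2.2)
      have h2 := hz e he.1 he.2.1 he.2.2
      have h3 := hcol c hc.1 d hd.1 e he.1 hcd hce hde
      have h4 : r * eval (P e) (lin (cr (P c) (P d))) = 0 := by
        rw [← h2]; simp only [eval_lin]; simp; ring
      have h5 : r = 0 := (mul_eq_zero.1 h4).resolve_right h3
      rw [hm, h5]; simp [lin]
    have h0 : eval (P i + P j) c₁ ≠ 0 := fun h => hne (key _ h₁ hv₁ h)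
    refine ⟨eval (P i + P j) c₂ / eval (P i + P j) c₁, ?_⟩
    rw [← sub_eq_zero]
    apply key
    · exact h₂.sub (h₁.C_mul _)
    · intro k hk
      simp [hv₁ k hk, hv₂ k hk]
    · simp [h0]

/-- Two cubics of the linear system with a common line are proportional. -/
lemma common_line {P : Fin 8 → Fin 3 → ℝ} (hP : Conf P) {n : Fin 3 → ℝ} (hn : n ≠ 0)
    {c₁ c₂ : MvPolynomial (Fin 3) ℝ} (h₁ : c₁.IsHomogeneous 2) (h₂ : c₂.IsHomogeneous 2)
    (hv₁ : ∀ i, eval (P i) (lin n * c₁) = 0) (hv₂ : ∀ i, eval (P i) (lin n * c₂) = 0)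
    (hne : c₁ ≠ 0) : ∃ c : ℝ, c₂ = C c * c₁ := by
  have hcard := hP.line n hn
  have := Finset.le_card_sdiff (Finset.univ.filter (fun l => eval (P l) (lin n) = 0)) Finset.univ
  rw [Finset.card_univ, Fintype.card_fin] at this
  refine five hP (Finset.univ \ Finset.univ.filter (fun l => eval (P l) (lin n) = 0)) (by omega)
    h₁ h₂ ?_ ?_ hne
  · intro i hi
    simp only [Finset.mem_sdiff, Finset.mem_filter, Finset.mem_univ, true_and] at hi
    have := hv₁ i
    rw [map_mul] at this
    exact (mul_eq_zero.1 this).resolve_left hi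
  · intro i hi
    simp only [Finset.mem_sdiff, Finset.mem_filter, Finset.mem_univ, true_and] at hi
    have := hv₂ i
    rw [map_mul] at this
    exact (mul_eq_zero.1 this).resolve_left hi

lemma seven_conic {P : Fin 8 → Fin 3 → ℝ} (hP : Conf P) {c : MvPolynomial (Fin 3) ℝ}
    (hc : c.IsHomogeneous 2) (i₀ : Fin 8) (h : ∀ i, i ≠ i₀ → eval (P i) c = 0) : c = 0 := by
  by_contra hne
  have h1 := hP.conic c hne hc
  have h2 : Finset.univ.erase i₀ ⊆ Finset.univ.filter (fun i => eval (P i) c = 0) := by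
    intro i hi
    simp at hi ⊢
    exact h i hi
  have := Finset.card_le_card h2
  rw [Finset.card_erase_of_mem (Finset.mem_univ _), Finset.card_univ, Fintype.card_fin] at this
  omega

/-- Evaluation functional. -/
def evL (x : Fin 3 → ℝ) : MvPolynomial (Fin 3) ℝ →ₗ[ℝ] ℝ := (MvPolynomial.aeval x).toLinearMap

lemma evL_apply (x : Fin 3 → ℝ) (p : MvPolynomial (Fin 3) ℝ) : evL x p = eval x p := by
  simp [evL, MvPolynomial.aeval_eq_eval]

lemma ker_two {V : Submodule ℝ (MvPolynomial (Fin 3) ℝ)} [FiniteDimensional ℝ V]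
    (φ ψ : MvPolynomial (Fin 3) ℝ →ₗ[ℝ] ℝ) (h : 2 < Module.finrank ℝ V) :
    ∃ p ∈ V, p ≠ 0 ∧ φ p = 0 ∧ ψ p = 0 := by
  let Φ : V →ₗ[ℝ] ℝ × ℝ := (φ.prod ψ).comp V.subtype
  have : LinearMap.ker Φ ≠ ⊥ := LinearMap.ker_ne_bot_of_finrank_lt (by simpa using h)
  obtain ⟨p, hp, hne⟩ := Submodule.exists_mem_ne_zero_of_ne_bot this
  have hp' : Φ p = 0 := hp
  exact ⟨p, p.2, by simpa using hne, congrArg Prod.fst hp', congrArg Prod.snd hp'⟩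

lemma ker_one {V : Submodule ℝ (MvPolynomial (Fin 3) ℝ)} [FiniteDimensional ℝ V]
    (φ : MvPolynomial (Fin 3) ℝ →ₗ[ℝ] ℝ) (hV : 2 < Module.finrank ℝ V)
    (h : ∀ p ∈ V, ∀ q ∈ V, φ p = 0 → φ q = 0 → p ≠ 0 → ∃ c : ℝ, q = C c * p) : False := by
  obtain ⟨p, hp, hne, hφ, -⟩ := ker_two φ 0 hV
  have : ∃ i, p.coeff i ≠ 0 := MvPolynomial.ne_zero_iff.1 hne
  obtain ⟨i, hi⟩ := this
  obtain ⟨q, hq, hqne, hφq, hψ⟩ := ker_two φ (MvPolynomial.lcoeff ℝ i) hV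
  obtain ⟨c, rfl⟩ := h p hp q hq hφ hφq hne
  simp [hi] at hψ
  exact hqne (by simp [hψ])

lemma upper {P : Fin 8 → Fin 3 → ℝ} (hP : Conf P) (V : Submodule ℝ (MvPolynomial (Fin 3) ℝ))
    [FiniteDimensional ℝ V]
    (hV : ∀ p, p ∈ V ↔ p.IsHomogeneous 3 ∧ ∀ i, eval (P i) p = 0) : Module.finrank ℝ V ≤ 2 := by
  by_contra! hlt
  by_cases hcol : ∃ i j k, i ≠ j ∧ i ≠ k ∧ j ≠ k ∧ eval (P k) (lin (cr (P i) (P j))) = 0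
  · obtain ⟨i, j, k, hij, hik, hjk, hc⟩ := hcol
    have hn := hP.ind i j hij
    obtain ⟨α, β, hα, hβ, hPk⟩ := third hn (hP.ind i k hik) (hP.ind j k hjk) hc
    have key : ∀ p ∈ V, (evL (P i + P j) - evL (P i - P j)) p = 0 →
        ∃ q, q.IsHomogeneous 2 ∧ p = lin (cr (P i) (P j)) * q := by
      intro p hp hφ
      rw [hV] at hp
      rw [LinearMap.sub_apply, evL_apply, evL_apply] at hφ
      have hk := hp.2 k
      rw [hPk, cub_line hp.1, hp.2 i, hp.2 j, hφ] at hk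
      have h2 : ((eval (P i + P j) p + eval (P i - P j) p) / 2) * (α * β ^ 2) = 0 := by
        linear_combination hk
      have h3 : (eval (P i + P j) p + eval (P i - P j) p) / 2 = 0 :=
        (mul_eq_zero.1 h2).resolve_right (by positivity)
      refine cubic_line hp.1 hn fun x y => ?_
      rw [cub_line hp.1, hp.2 i, hp.2 j, hφ, h3]; ring
    refine ker_one (evL (P i + P j) - evL (P i - P j)) hlt fun p hp q hq hφp hφq hne => ?_
    obtain ⟨c₁, hc₁, rfl⟩ := key p hp hφp
    obtain ⟨c₂, hc₂, rfl⟩ := key q hq hφq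
    obtain ⟨c, rfl⟩ := common_line hP hn hc₁ hc₂ ((hV _).1 hp).2 ((hV _).1 hq).2 (by
      rintro rfl; simp at hne)
    exact ⟨c, by ring⟩
  · push Not at hcol
    have key : ∀ i j, i ≠ j → ∃ q : MvPolynomial (Fin 3) ℝ, q ≠ 0 ∧ q.IsHomogeneous 2 ∧
        ∀ k, k ≠ i → k ≠ j → eval (P k) q = 0 := by
      intro i j hij
      obtain ⟨p, hp, hne, hφ, hψ⟩ := ker_two (evL (P i + P j)) (evL (P i - P j)) hlt
      rw [evL_apply] at hφ hψ
      rw [hV] at hp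
      obtain ⟨q, hq, rfl⟩ := cubic_line hp.1 (hP.ind i j hij) (fun x y => by
        rw [cub_line hp.1, hp.2 i, hp.2 j, hφ, hψ]; ring)
      refine ⟨q, by rintro rfl; simp at hne, hq, fun k hki hkj => ?_⟩
      have := hp.2 k
      rw [map_mul] at this
      exact (mul_eq_zero.1 this).resolve_left (hcol i j k hij hki.symm hkj.symm)
    obtain ⟨q, hq0, hq, hqv⟩ := key 0 1 (by decide)
    obtain ⟨r, hr0, hr, hrv⟩ := key 0 2 (by decide)
    obtain ⟨c, rfl⟩ := five hP {3, 4, 5, 6, 7} (by decide) hq hr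
      (fun i hi => hqv i (by rintro rfl; revert hi; decide) (by rintro rfl; revert hi; decide))
      (fun i hi => hrv i (by rintro rfl; revert hi; decide) (by rintro rfl; revert hi; decide)) hq0
    apply hr0
    refine seven_conic hP hr 0 fun i hi => ?_
    by_cases h2 : i = 2
    · subst h2
      rw [map_mul, hqv 2 (by decide) (by decide), mul_zero]
    · exact hrv i hi h2

section alg
open Polynomial

lemma alg_eq {q h l r d : ℝ[X]} (hq : q.natDegree = 2) (hh : h.natDegree ≤ 3)
    (hl : l.natDegree ≤ 1) (hr : r.natDegree ≤ 2)
    (hB : h ^ 2 * l - h * q * r + q ^ 2 * d = 0)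
    (hno1 : ∀ z : ℝ, ¬ (q.eval z = 0 ∧ h.eval z = 0))
    (hno2 : ∀ m0 m1 : ℝ, h ≠ q * (Polynomial.C m1 * Polynomial.X + Polynomial.C m0)) :
    l = 0 ∧ ∃ e : ℝ, r = Polynomial.C e * q ∧ d = Polynomial.C e * h := by
  have hq0 : q ≠ 0 := by rintro rfl; simp at hq
  have hcop : IsCoprime q h := by
    apply isCoprime_of_irreducible_dvd (fun hx => hq0 hx.1)
    intro p hp hpq hph
    have h1 := natDegree_le_of_dvd hpq hq0
    have h2 : 0 < p.natDegree := hp.natDegree_pos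
    rw [hq] at h1
    have h3 : p.natDegree = 1 ∨ p.natDegree = 2 := by omega
    rcases h3 with h3 | h3
    · obtain ⟨z, hz⟩ := exists_root_of_degree_eq_one (degree_eq_iff_natDegree_eq_of_pos one_pos |>.2 h3)
      exact hno1 z ⟨(hz.dvd hpq), (hz.dvd hph)⟩
    · have h4 : q ∣ h := by
        have : Associated p q := associated_of_dvd_of_natDegree_le hpq hq0 (by omega)
        exact this.symm.dvd.trans hph
      obtain ⟨m, hm⟩ := h4
      have h5 : m.natDegree ≤ 1 := by
        by_cases hm0 : m = 0
        · simp [hm0]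
        · have := natDegree_mul hq0 hm0
          rw [← hm, hq] at this
          omega
      obtain ⟨m1, m0, rfl⟩ := exists_eq_X_add_C_of_natDegree_le_one h5
      exact hno2 _ _ hm
  have hl0 : l = 0 := by
    have : q ∣ h ^ 2 * l := ⟨h * r - q * d, by linear_combination hB⟩
    exact eq_zero_of_dvd_of_natDegree_lt ((hcop.pow_right).dvd_of_dvd_mul_left this) (by omega)
  refine ⟨hl0, ?_⟩
  have h6 : h * r = q * d := by
    apply mul_left_cancel₀ hq0
    rw [hl0] at hB
    linear_combination -hB
  obtain ⟨m, hm⟩ : q ∣ r := hcop.dvd_of_dvd_mul_left ⟨d, h6⟩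
  have h7 : m.natDegree = 0 := by
    by_cases hm0 : m = 0
    · simp [hm0]
    · have := natDegree_mul hq0 hm0
      rw [← hm, hq] at this
      omega
  obtain ⟨e, rfl⟩ := natDegree_eq_zero.1 h7
  refine ⟨e, by rw [hm]; ring, ?_⟩
  apply mul_left_cancel₀ hq0
  rw [← h6, hm]; ring

lemma alg (c d : Fin 10 → ℝ) (hc5 : c 5 ≠ 0) (z a : Fin 8 → ℝ) (hz : Function.Injective z)
    (hh : ∀ i, a i * (c 3 + c 4 * z i + c 5 * z i ^ 2)
      + (c 6 + c 7 * z i + c 8 * z i ^ 2 + c 9 * z i ^ 3) = 0)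
    (hg : ∀ i, a i ^ 2 * (d 1 + d 2 * z i) + a i * (d 3 + d 4 * z i + d 5 * z i ^ 2)
      + (d 6 + d 7 * z i + d 8 * z i ^ 2 + d 9 * z i ^ 3) = 0)
    (hno1 : ∀ z : ℝ, ¬ (c 3 + c 4 * z + c 5 * z ^ 2 = 0 ∧
      c 6 + c 7 * z + c 8 * z ^ 2 + c 9 * z ^ 3 = 0))
    (hno2 : ∀ m0 m1 : ℝ, ¬ (c 6 = c 3 * m0 ∧ c 7 = c 3 * m1 + c 4 * m0 ∧
      c 8 = c 4 * m1 + c 5 * m0 ∧ c 9 = c 5 * m1)) :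
    d 1 = 0 ∧ d 2 = 0 ∧ ∃ e, ∀ i : Fin 10, 3 ≤ i → d i = e * c i := by
  let q : ℝ[X] := Polynomial.C (c 5) * Polynomial.X ^ 2 + Polynomial.C (c 4) * Polynomial.X + Polynomial.C (c 3)
  let r : ℝ[X] := Polynomial.C (d 5) * Polynomial.X ^ 2 + Polynomial.C (d 4) * Polynomial.X + Polynomial.C (d 3)
  let h : ℝ[X] := Polynomial.C (c 9) * Polynomial.X ^ 3 + Polynomial.C (c 8) * Polynomial.X ^ 2
    + Polynomial.C (c 7) * Polynomial.X + Polynomial.C (c 6)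
  let k : ℝ[X] := Polynomial.C (d 9) * Polynomial.X ^ 3 + Polynomial.C (d 8) * Polynomial.X ^ 2
    + Polynomial.C (d 7) * Polynomial.X + Polynomial.C (d 6)
  let l : ℝ[X] := Polynomial.C (d 2) * Polynomial.X + Polynomial.C (d 1)
  have hq : q.natDegree = 2 := natDegree_quadratic hc5
  have hr : r.natDegree ≤ 2 := natDegree_quadratic_le
  have hhd : h.natDegree ≤ 3 := natDegree_cubic_le
  have hk : k.natDegree ≤ 3 := natDegree_cubic_le
  have hl : l.natDegree ≤ 1 := natDegree_linear_le
  have hB : h ^ 2 * l - h * q * r + q ^ 2 * k = 0 := by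
    apply eq_zero_of_natDegree_lt_card_of_eval_eq_zero _ hz
    · intro i
      have e1 : q.eval (z i) = c 3 + c 4 * z i + c 5 * z i ^ 2 := by simp [q]; ring
      have e2 : r.eval (z i) = d 3 + d 4 * z i + d 5 * z i ^ 2 := by simp [r]; ring
      have e3 : h.eval (z i) = c 6 + c 7 * z i + c 8 * z i ^ 2 + c 9 * z i ^ 3 := by simp [h]; ring
      have e4 : k.eval (z i) = d 6 + d 7 * z i + d 8 * z i ^ 2 + d 9 * z i ^ 3 := by simp [k]; ring
      have e5 : l.eval (z i) = d 1 + d 2 * z i := by simp [l]; ring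
      have h1 := hh i
      have h2 := hg i
      rw [← e1, ← e3] at h1
      rw [← e5, ← e2, ← e4] at h2
      have h3 : h.eval (z i) = - (a i * q.eval (z i)) := by linear_combination h1
      simp only [Polynomial.eval_add, Polynomial.eval_sub, Polynomial.eval_mul, Polynomial.eval_pow]
      rw [h3]
      linear_combination (q.eval (z i)) ^ 2 * h2
    · rw [Fintype.card_fin]
      have b1 : (h ^ 2 * l).natDegree ≤ 7 :=
        natDegree_mul_le.trans (by have := natDegree_pow_le (p := h) (n := 2); omega)
      have b2 : (h * q * r).natDegree ≤ 7 :=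
        natDegree_mul_le.trans (by have := natDegree_mul_le (p := h) (q := q); omega)
      have b3 : (q ^ 2 * k).natDegree ≤ 7 :=
        natDegree_mul_le.trans (by have := natDegree_pow_le (p := q) (n := 2); omega)
      have b4 := natDegree_sub_le (h ^ 2 * l) (h * q * r)
      have b5 := natDegree_add_le (h ^ 2 * l - h * q * r) (q ^ 2 * k)
      omega
  obtain ⟨hl0, e, hre, hke⟩ := alg_eq hq hhd hl hr hB (by
    intro x hx
    apply hno1 x
    constructor
    · rw [← hx.1]; simp [q]; ring
    · rw [← hx.2]; simp [h]; ring) (by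
    intro m0 m1 hm
    apply hno2 m0 m1
    have hm' : (⟨c 9, c 8, c 7, c 6⟩ : Cubic ℝ).toPoly =
        (⟨c 5 * m1, c 4 * m1 + c 5 * m0, c 3 * m1 + c 4 * m0, c 3 * m0⟩ : Cubic ℝ).toPoly := by
      refine Eq.trans hm ?_
      simp [q, Cubic.toPoly]; ring
    rw [Cubic.toPoly_injective, Cubic.mk.injEq] at hm'
    exact ⟨hm'.2.2.2, hm'.2.2.1, hm'.2.1, hm'.1⟩)
  have f1 : (⟨0, 0, d 2, d 1⟩ : Cubic ℝ).toPoly = (⟨0, 0, 0, 0⟩ : Cubic ℝ).toPoly := by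
    have : l = 0 := hl0
    simp only [l] at this
    simp [Cubic.toPoly, this]
  have f2 : (⟨0, d 5, d 4, d 3⟩ : Cubic ℝ).toPoly =
      (⟨0, e * c 5, e * c 4, e * c 3⟩ : Cubic ℝ).toPoly := by
    have : r = _ := hre
    simp only [r, q] at this
    simp only [Cubic.toPoly, Polynomial.C_0, zero_mul, zero_add, this, Polynomial.C_mul]
    ring
  have f3 : (⟨d 9, d 8, d 7, d 6⟩ : Cubic ℝ).toPoly =
      (⟨e * c 9, e * c 8, e * c 7, e * c 6⟩ : Cubic ℝ).toPoly := by
    have : k = _ := hke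
    simp only [k, h] at this
    simp only [Cubic.toPoly, this, Polynomial.C_mul]
    ring
  rw [Cubic.toPoly_injective, Cubic.mk.injEq] at f1 f2 f3
  refine ⟨f1.2.2.2, f1.2.2.1, e, ?_⟩
  intro i hi
  fin_cases i
  · exact absurd hi (by decide)
  · exact absurd hi (by decide)
  · exact absurd hi (by decide)
  exacts [f2.2.2.2, f2.2.2.1, f2.2.1, f3.2.2.2, f3.2.2.1, f3.2.1, f3.1]
end alg

lemma exists_eval_ne {p : MvPolynomial (Fin 3) ℝ} (hp : p ≠ 0) : ∃ x, eval x p ≠ 0 := by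
  by_contra! h
  exact hp (MvPolynomial.funext fun x => by rw [h x, map_zero])

lemma lin_eval_smul (n x : Fin 3 → ℝ) (r : ℝ) : eval x (lin (r • n)) = r * eval x (lin n) := by
  simp only [eval_lin]; simp; ring

lemma lin_cyc (a b c : Fin 3 → ℝ) : eval c (lin (cr a b)) = - eval b (lin (cr a c)) := by
  simp only [eval_lin]; simp; ring

lemma nodal_line {h : MvPolynomial (Fin 3) ℝ} (hh : h.IsHomogeneous 3) {u : Fin 3 → ℝ}
    (hu : eval u h = 0) (hs : ∀ i, eval u (pderiv i h) = 0) (v : Fin 3 → ℝ) (x y : ℝ) :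
    eval (x • u + y • v) h = (eval (u + v) h - eval v h) * (x * y ^ 2) + eval v h * y ^ 3 := by
  have h1 := cub_grad hh u v
  rw [hs, hs, hs] at h1
  rw [cub_line hh, hu]
  linear_combination (x ^ 2 * y - x * y ^ 2) * h1

lemma realsing {P : Fin 8 → Fin 3 → ℝ} (hind : ∀ i j, i ≠ j → cr (P i) (P j) ≠ 0)
    {h g : MvPolynomial (Fin 3) ℝ} (hh : h.IsHomogeneous 3) (hg : g.IsHomogeneous 3)
    (hvh : ∀ i, eval (P i) h = 0) (hvg : ∀ i, eval (P i) g = 0)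
    (hnp : ¬ ∃ e : ℝ, g = C e * h) {u : Fin 3 → ℝ} (hu : eval u h = 0)
    (hs : ∀ i, eval u (pderiv i h) = 0) (hgu : eval u g = 0) (huP : ∀ i, cr u (P i) ≠ 0)
    (hnl : ∀ a b, cr a b ≠ 0 → ∃ x y : ℝ, eval (x • a + y • b) h ≠ 0) : False := by
  have hline := nodal_line hh hu hs
  have hQ : ∀ i, eval (u + P i) h ≠ 0 := by
    intro i h0
    obtain ⟨x, y, hxy⟩ := hnl _ _ (huP i)
    apply hxy
    rw [hline, hvh, h0]; ring
  have step1 : ∀ i j, i ≠ j → eval (P j) (lin (cr u (P i))) ≠ 0 := by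
    intro i j hij h0
    obtain ⟨α, β, hα, hβ, hj⟩ := third (huP i) (huP j) (hind i j hij) h0
    have h1 := hvh j
    rw [hj, hline, hvh i] at h1
    have h2 : eval (u + P i) h * (α * β ^ 2) = 0 := by linear_combination h1
    rcases mul_eq_zero.1 h2 with h3 | h3
    · exact hQ i h3
    · exact absurd h3 (mul_ne_zero hα (pow_ne_zero _ hβ))
  let Qp : MvPolynomial (Fin 3) ℝ := bind₁ (fun i => X i + C (u i)) h - h
  have hQp : ∀ x, eval x Qp = eval (u + x) h - eval x h := by
    intro x
    simp only [Qp, map_sub, eval_bind]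
    congr 3
    funext i
    simp; ring
  have hQp0 : Qp ≠ 0 := by
    intro h0
    have := hQp (P 0)
    rw [h0, hvh 0, map_zero, sub_zero] at this
    exact hQ 0 this.symm
  obtain ⟨w, hw⟩ := exists_eval_ne (mul_ne_zero hQp0
    (Finset.prod_ne_zero_iff.2 fun i (_ : i ∈ Finset.univ) => lin_ne (huP i)))
  rw [map_mul, map_prod, hQp] at hw
  obtain ⟨hw1, hw2⟩ := mul_ne_zero_iff.1 hw
  rw [Finset.prod_ne_zero_iff] at hw2
  set v := cr u w with hv
  have hv0 : v ≠ 0 := by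
    intro h0
    apply hw2 0 (Finset.mem_univ _)
    rw [lin_cyc, ← hv, h0]; simp [lin]
  have hN : v 0 ^ 2 + v 1 ^ 2 + v 2 ^ 2 ≠ 0 := by
    intro h0
    apply hv0
    funext i
    fin_cases i <;> simp <;> nlinarith [sq_nonneg (v 0), sq_nonneg (v 1), sq_nonneg (v 2)]
  have hdec : ∀ x : Fin 3 → ℝ, ∃ α γ : ℝ,
      x = α • u + (eval x (lin v) / (v 0 ^ 2 + v 1 ^ 2 + v 2 ^ 2)) • v + γ • w := by
    intro x
    obtain ⟨α, γ, h1⟩ := span_of_perp hv0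
      (x := x - (eval x (lin v) / (v 0 ^ 2 + v 1 ^ 2 + v 2 ^ 2)) • v) (by
        rw [← hv]
        simp only [eval_lin, Pi.sub_apply, Pi.smul_apply, smul_eq_mul]
        field_simp
        ring)
    refine ⟨α, γ, ?_⟩
    rw [add_right_comm, ← h1, sub_add_cancel]
  choose α γ hPd using fun i => hdec (P i)
  have hβ : ∀ i, eval (P i) (lin v) / (v 0 ^ 2 + v 1 ^ 2 + v 2 ^ 2) ≠ 0 := by
    intro i
    refine div_ne_zero ?_ hN
    rw [hv, lin_cyc]
    exact neg_ne_zero.2 (hw2 i (Finset.mem_univ _))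
  generalize hβd : (fun i => eval (P i) (lin v) / (v 0 ^ 2 + v 1 ^ 2 + v 2 ^ 2)) = β at *
  have hβd' : ∀ i, eval (P i) (lin v) / (v 0 ^ 2 + v 1 ^ 2 + v 2 ^ 2) = β i := fun i => congrFun hβd i
  simp only [hβd'] at hβ hPd
  obtain ⟨c, hc⟩ := cub_sub hh u v w
  obtain ⟨d, hd⟩ := cub_sub hg u v w
  have hc0 : c 0 = 0 := by
    have := hc 1 0 0
    simpa [hu] using this.symm
  have hd0 : d 0 = 0 := by
    have := hd 1 0 0
    simpa [hgu] using this.symm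
  have hcv : c 1 = 0 := by
    have e1 := hc 1 1 0
    have e2 := hc 1 (-1) 0
    have e3 := hc 0 1 0
    have e4 := hline v 1 1
    have e5 := hline v 1 (-1)
    simp at e1 e2 e3 e4 e5
    linarith
  have hcw : c 2 = 0 ∧ c 5 = eval (u + w) h - eval w h := by
    have e1 := hc 1 0 1
    have e2 := hc 1 0 (-1)
    have e3 := hc 0 0 1
    have e4 := hline w 1 1
    have e5 := hline w 1 (-1)
    simp at e1 e2 e3 e4 e5
    constructor <;> linarith
  obtain ⟨hc2, hc5⟩ := hcw
  have hz : Function.Injective (fun i => γ i / β i) := by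
    intro i j hij
    by_contra hne
    apply step1 i j hne
    have h1 : γ i / β i = γ j / β j := hij
    rw [div_eq_div_iff (hβ i) (hβ j)] at h1
    rw [eval_lin]
    have hi : ∀ k, P i k = α i * u k + β i * v k + γ i * w k := fun k => by
      conv_lhs => rw [hPd i]
      simp
    have hj : ∀ k, P j k = α j * u k + β j * v k + γ j * w k := fun k => by
      conv_lhs => rw [hPd j]
      simp
    simp only [cr0, cr1, cr2, hi, hj]
    linear_combination (-(u 0 * (v 1 * w 2 - v 2 * w 1) + u 1 * (v 2 * w 0 - v 0 * w 2)
      + u 2 * (v 0 * w 1 - v 1 * w 0))) * h1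
  have hcr1 : ∀ z : ℝ, cr u (v + z • w) ≠ 0 := by
    intro z h0
    apply hN
    have e0 := congrFun h0 0
    have e1 := congrFun h0 1
    have e2 := congrFun h0 2
    simp only [cr0, cr1, cr2, Pi.add_apply, Pi.smul_apply, smul_eq_mul, Pi.zero_apply] at e0 e1 e2
    simp only [hv, cr0, cr1, cr2] at e0 e1 e2 ⊢
    linear_combination -(w 0) * e0 - w 1 * e1 - w 2 * e2
  have hcr2 : ∀ m0 m1 : ℝ, cr (v - m0 • u) (w - m1 • u) ≠ 0 := by
    intro m0 m1 h0
    apply hN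
    have e0 := congrFun h0 0
    have e1 := congrFun h0 1
    have e2 := congrFun h0 2
    simp only [cr0, cr1, cr2, Pi.sub_apply, Pi.smul_apply, smul_eq_mul, Pi.zero_apply] at e0 e1 e2
    simp only [hv, cr0, cr1, cr2] at e0 e1 e2 ⊢
    linear_combination -(u 0) * e0 - u 1 * e1 - u 2 * e2
  obtain ⟨hd1, hd2, e, he⟩ := alg c d (by rw [hc5]; exact hw1) (fun i => γ i / β i)
    (fun i => α i / β i) hz
    (by
      intro i
      have h1 := hvh i
      rw [hPd i, hc, hc0, hcv, hc2] at h1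
      have := hβ i
      field_simp
      linear_combination h1)
    (by
      intro i
      have h1 := hvg i
      rw [hPd i, hd, hd0] at h1
      have := hβ i
      field_simp
      linear_combination h1)
    (by
      rintro z ⟨h1, h2⟩
      obtain ⟨x, y, hxy⟩ := hnl _ _ (hcr1 z)
      apply hxy
      have : x • u + y • (v + z • w) = x • u + y • v + (y * z) • w := by module
      rw [this, hc, hc0, hcv, hc2]
      linear_combination (x * y ^ 2) * h1 + y ^ 3 * h2)
    (by
      rintro m0 m1 ⟨h1, h2, h3, h4⟩
      obtain ⟨x, y, hxy⟩ := hnl _ _ (hcr2 m0 m1)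
      apply hxy
      have : x • (v - m0 • u) + y • (w - m1 • u) = (-(x * m0) - y * m1) • u + x • v + y • w := by module
      rw [this, hc, hc0, hcv, hc2, h1, h2, h3, h4]
      ring)
  apply hnp
  refine ⟨e, MvPolynomial.funext fun x => ?_⟩
  obtain ⟨a, b, hx⟩ := hdec x
  rw [map_mul, eval_C, hx, hc, hd, hc0, hcv, hc2, hd0, hd1, hd2, he 3 (by decide), he 4 (by decide),
    he 5 (by decide), he 6 (by decide), he 7 (by decide), he 8 (by decide), he 9 (by decide)]
  ring

lemma line_pair {P : Fin 8 → Fin 3 → ℝ} (hP : Conf P) {h₁ h₂ : MvPolynomial (Fin 3) ℝ}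
    (hh₁ : h₁.IsHomogeneous 3) (hh₂ : h₂.IsHomogeneous 3)
    (hv₁ : ∀ i, eval (P i) h₁ = 0) (hv₂ : ∀ i, eval (P i) h₂ = 0) (hne : h₁ ≠ 0)
    {a b : Fin 3 → ℝ} (hab : cr a b ≠ 0) (hl₁ : ∀ x y : ℝ, eval (x • a + y • b) h₁ = 0)
    (hl₂ : ∀ x y : ℝ, eval (x • a + y • b) h₂ = 0) : ∃ c : ℝ, h₂ = C c * h₁ := by
  obtain ⟨c₁, hc₁, rfl⟩ := cubic_line hh₁ hab hl₁
  obtain ⟨c₂, hc₂, rfl⟩ := cubic_line hh₂ hab hl₂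
  obtain ⟨c, rfl⟩ := common_line hP hab hc₁ hc₂ hv₁ hv₂ (by rintro rfl; simp at hne)
  exact ⟨c, by ring⟩

lemma on_line {P : Fin 8 → Fin 3 → ℝ} (hP : Conf P) {h : MvPolynomial (Fin 3) ℝ}
    (hh : h.IsHomogeneous 3) (hv : ∀ i, eval (P i) h = 0) (hne : h ≠ 0)
    {a b : Fin 3 → ℝ} (hab : cr a b ≠ 0) (hl : ∀ x y : ℝ, eval (x • a + y • b) h = 0) :
    ∃ i j, i ≠ j ∧ ∀ x y : ℝ, eval (x • P i + y • P j) h = 0 := by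
  obtain ⟨q, hq, rfl⟩ := cubic_line hh hab hl
  have hq0 : q ≠ 0 := by rintro rfl; simp at hne
  have h1 := hP.conic q hq0 hq
  have h2 := Finset.le_card_sdiff (Finset.univ.filter (fun l => eval (P l) q = 0)) Finset.univ
  rw [Finset.card_univ, Fintype.card_fin] at h2
  obtain ⟨i, hi, j, hj, hij⟩ := Finset.one_lt_card.1
    (show 1 < (Finset.univ \ Finset.univ.filter (fun l => eval (P l) q = 0)).card by omega)
  simp only [Finset.mem_sdiff, Finset.mem_filter, Finset.mem_univ, true_and] at hi hj
  have e1 := hv i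
  have e2 := hv j
  rw [map_mul] at e1 e2
  obtain ⟨c, hc⟩ := lin_prop (hP.ind i j hij) ((mul_eq_zero.1 e1).resolve_right hi)
    ((mul_eq_zero.1 e2).resolve_right hj)
  refine ⟨i, j, hij, fun x y => ?_⟩
  rw [map_mul, hc, lin_eval_smul, perp_span]; ring

lemma sing_two {P : Fin 8 → Fin 3 → ℝ} (hP : Conf P) {f g : MvPolynomial (Fin 3) ℝ}
    (hf : f.IsHomogeneous 3) (hg : g.IsHomogeneous 3)
    (hvf : ∀ i, eval (P i) f = 0) (hvg : ∀ i, eval (P i) g = 0)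
    (hind : ∀ a b : ℝ, C a * f + C b * g = 0 → a = 0 ∧ b = 0) (i : Fin 8)
    (hsf : ∀ k, eval (P i) (pderiv k f) = 0) (hsg : ∀ k, eval (P i) (pderiv k g) = 0) : False := by
  have key : ∀ j, j ≠ i → ∃ k, k ≠ i ∧ k ≠ j ∧ eval (P k) (lin (cr (P i) (P j))) = 0 := by
    intro j hji
    by_contra! hno
    obtain ⟨a, b, hab, h0⟩ : ∃ a b : ℝ, ¬ (a = 0 ∧ b = 0) ∧
        eval (P i + P j) (C a * f + C b * g) = 0 := by
      by_cases hz : eval (P i + P j) g = 0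
      · exact ⟨0, 1, by simp, by simp [hz]⟩
      · exact ⟨eval (P i + P j) g, - eval (P i + P j) f, by simp [hz], by simp; ring⟩
    have hne : C a * f + C b * g ≠ 0 := fun h => hab (hind a b h)
    have hh : (C a * f + C b * g).IsHomogeneous 3 := (hf.C_mul a).add (hg.C_mul b)
    have hv : ∀ k, eval (P k) (C a * f + C b * g) = 0 := fun k => by simp [hvf, hvg]
    have hs : ∀ k, eval (P i) (pderiv k (C a * f + C b * g)) = 0 := fun k => by simp [hsf, hsg]
    generalize C a * f + C b * g = h at *
    have hn := hP.ind i j hji.symm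
    obtain ⟨q, hq, rfl⟩ := cubic_line hh hn (fun x y => by
      rw [nodal_line hh (hv i) hs, h0, hv j]; ring)
    obtain ⟨k, hk⟩ := Function.ne_iff.1 hn
    have hqi : eval (P i) q = 0 := by
      have h1 := hs k
      rw [Derivation.leibniz, map_add, smul_eq_mul, smul_eq_mul, map_mul, map_mul,
        perp_left, zero_mul, zero_add] at h1
      have h2 : eval (P i) (pderiv k (lin (cr (P i) (P j)))) = cr (P i) (P j) k := by
        fin_cases k <;> simp [lin, pderiv_X]
      rw [h2] at h1
      exact (mul_eq_zero.1 h1).resolve_right hk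
    have : q = 0 := seven_conic hP hq j fun l hl => by
      by_cases hli : l = i
      · rw [hli, hqi]
      · have h1 := hv l
        rw [map_mul] at h1
        exact (mul_eq_zero.1 h1).resolve_left (hno l hli hl)
    rw [this, mul_zero] at hne
    exact hne rfl
  have uniq : ∀ j k l, j ≠ i → k ≠ i → k ≠ j → l ≠ i → l ≠ j →
      eval (P k) (lin (cr (P i) (P j))) = 0 → eval (P l) (lin (cr (P i) (P j))) = 0 → k = l := by
    intro j k l hji hki hkj hli hlj hk hl
    by_contra hkl
    have h1 := hP.line _ (hP.ind i j hji.symm)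
    have h2 : ({i, j, k, l} : Finset (Fin 8)) ⊆
        Finset.univ.filter (fun m => eval (P m) (lin (cr (P i) (P j))) = 0) := by
      intro m hm
      simp only [Finset.mem_insert, Finset.mem_singleton] at hm
      simp only [Finset.mem_filter, Finset.mem_univ, true_and]
      rcases hm with rfl | rfl | rfl | rfl
      exacts [perp_left _ _, perp_right _ _, hk, hl]
    have h3 := Finset.card_le_card h2
    have h4 : ({i, j, k, l} : Finset (Fin 8)).card = 4 := by
      rw [Finset.card_insert_of_notMem, Finset.card_insert_of_notMem,
        Finset.card_insert_of_notMem, Finset.card_singleton]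
      · simpa using hkl
      · simp [hkj.symm, hlj.symm]
      · simp [hji.symm, hki.symm, hli.symm]
    omega
  choose! σ hσ using key
  have hsum := Finset.sum_involution (s := Finset.univ.erase i) (f := fun _ => (1 : ZMod 2))
    (fun j _ => σ j) (fun _ _ => by decide)
    (fun j hj _ => (hσ j (Finset.ne_of_mem_erase hj)).2.1)
    (fun j hj => Finset.mem_erase.2 ⟨(hσ j (Finset.ne_of_mem_erase hj)).1, Finset.mem_univ _⟩)
    (fun j hj => by
      have hji := Finset.ne_of_mem_erase hj
      obtain ⟨a1, a2, a3⟩ := hσ j hji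
      obtain ⟨b1, b2, b3⟩ := hσ (σ j) a1
      refine uniq (σ j) _ _ a1 b1 b2 hji a2.symm b3 ?_
      rw [lin_cyc, a3, neg_zero])
  rw [Finset.sum_const, Finset.card_erase_of_mem (Finset.mem_univ _), Finset.card_univ,
    Fintype.card_fin] at hsum
  revert hsum
  decide

/-- extension of scalars -/
abbrev mC (h : MvPolynomial (Fin 3) ℝ) : MvPolynomial (Fin 3) ℂ := MvPolynomial.map (algebraMap ℝ ℂ) h

lemma eval_real (h : MvPolynomial (Fin 3) ℝ) (x : Fin 3 → ℝ) :
    eval (fun i => (x i : ℂ)) (mC h) = (eval x h : ℝ) := by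
  induction h using MvPolynomial.induction_on with
  | C a => simp [mC]
  | add p q hp hq => simp only [mC, map_add] at *; rw [hp, hq]; simp
  | mul_X p j hp => simp only [mC, map_mul] at *; rw [hp]; simp

lemma eval_conj (h : MvPolynomial (Fin 3) ℝ) (u : Fin 3 → ℂ) :
    eval (fun i => (starRingEnd ℂ) (u i)) (mC h) = (starRingEnd ℂ) (eval u (mC h)) := by
  induction h using MvPolynomial.induction_on with
  | C a => simp [mC]
  | add p q hp hq => simp only [mC, map_add] at *; rw [hp, hq]
  | mul_X p j hp => simp only [mC, map_mul] at *; rw [hp]; simp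

lemma cub_line_C {p : MvPolynomial (Fin 3) ℝ} (hp : p.IsHomogeneous 3) (a b : Fin 3 → ℂ) (x y : ℂ) :
    eval (x • a + y • b) (mC p) = eval a (mC p) * x ^ 3
      + (b 0 * eval a (mC (pderiv 0 p)) + b 1 * eval a (mC (pderiv 1 p))
        + b 2 * eval a (mC (pderiv 2 p))) * (x ^ 2 * y)
      + (a 0 * eval b (mC (pderiv 0 p)) + a 1 * eval b (mC (pderiv 1 p))
        + a 2 * eval b (mC (pderiv 2 p))) * (x * y ^ 2)
      + eval b (mC p) * y ^ 3 := by
  obtain ⟨c, rfl⟩ := coefs3 hp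
  simp [mC, cub, pderiv_X]; ring

lemma smul_C {p : MvPolynomial (Fin 3) ℝ} (hp : p.IsHomogeneous 3) (a : Fin 3 → ℂ) (x : ℂ) :
    eval (x • a) (mC p) = x ^ 3 * eval a (mC p) := by
  obtain ⟨c, rfl⟩ := coefs3 hp
  simp [mC, cub]; ring

lemma smul_C' {p : MvPolynomial (Fin 3) ℝ} (hp : p.IsHomogeneous 3) (a : Fin 3 → ℂ) (x : ℂ) (k : Fin 3) :
    eval (x • a) (mC (pderiv k p)) = x ^ 2 * eval a (mC (pderiv k p)) := by
  obtain ⟨c, rfl⟩ := coefs3 hp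
  fin_cases k <;> simp [mC, cub, pderiv_X] <;> ring

lemma smul_R' {p : MvPolynomial (Fin 3) ℝ} (hp : p.IsHomogeneous 3) (a : Fin 3 → ℝ) (x : ℝ) (k : Fin 3) :
    eval (x • a) (pderiv k p) = x ^ 2 * eval a (pderiv k p) := by
  obtain ⟨c, rfl⟩ := coefs3 hp
  fin_cases k <;> simp [cub, pderiv_X] <;> ring

lemma cr_zero {a b : Fin 3 → ℝ} (h : cr a b = 0) (ha : a ≠ 0) : ∃ s : ℝ, b = s • a := by
  obtain ⟨k, hk⟩ := Function.ne_iff.1 ha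
  have hk : a k ≠ 0 := hk
  have e0 := congrFun h 0
  have e1 := congrFun h 1
  have e2 := congrFun h 2
  simp only [cr0, cr1, cr2, Pi.zero_apply] at e0 e1 e2
  refine ⟨b k / a k, ?_⟩
  funext i
  simp only [Pi.smul_apply, smul_eq_mul]
  rw [div_mul_eq_mul_div, eq_div_iff hk]
  fin_cases k <;> fin_cases i <;> simp <;>
    first
    | ring1
    | linear_combination e0
    | linear_combination -e0
    | linear_combination e1
    | linear_combination -e1
    | linear_combination e2
    | linear_combination -e2

lemma nonreal {h : MvPolynomial (Fin 3) ℝ} (hh : h.IsHomogeneous 3) {u : Fin 3 → ℂ}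
    (h0 : eval u (mC h) = 0) (hs : ∀ k, eval u (mC (pderiv k h)) = 0) (x y : ℝ) :
    eval (x • (fun i => (u i).re) + y • (fun i => (u i).im)) h = 0 := by
  have h1 := cub_line_C hh u (fun i => (starRingEnd ℂ) (u i))
    ((x - y * Complex.I) / 2) ((x + y * Complex.I) / 2)
  simp only [eval_conj, h0, hs, map_zero, mul_zero, zero_mul, add_zero] at h1
  have h2 : (((x - y * Complex.I) / 2) • u + ((x + y * Complex.I) / 2) • (fun i => (starRingEnd ℂ) (u i)))
      = fun i => ((x • (fun i => (u i).re) + y • (fun i => (u i).im) : Fin 3 → ℝ) i : ℂ) := by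
    funext i
    apply Complex.ext <;> simp <;> ring
  rw [h2, eval_real] at h1
  exact_mod_cast h1

lemma realpt {u : Fin 3 → ℂ} (hu : u ≠ 0) (h : cr (fun i => (u i).re) (fun i => (u i).im) = 0) :
    ∃ (v : Fin 3 → ℝ) (ζ : ℂ), v ≠ 0 ∧ ζ ≠ 0 ∧ u = ζ • (fun i => (v i : ℂ)) := by
  by_cases ha : (fun i => (u i).re) = 0
  · refine ⟨fun i => (u i).im, Complex.I, ?_, Complex.I_ne_zero, ?_⟩
    · intro hb
      apply hu
      funext i
      exact Complex.ext (congrFun ha i) (congrFun hb i)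
    · funext i
      have := congrFun ha i
      apply Complex.ext <;> simp at this ⊢
      exact this
  · obtain ⟨s, hs⟩ := cr_zero h ha
    refine ⟨_, 1 + s * Complex.I, ha, ?_, ?_⟩
    · intro h0
      have := congrArg Complex.re h0
      simp at this
    · funext i
      have := congrFun hs i
      apply Complex.ext <;> simp at this ⊢
      exact this

lemma pencil_finite {P : Fin 8 → Fin 3 → ℝ} (hP : Conf P) {f g : MvPolynomial (Fin 3) ℝ}
    (hf : f.IsHomogeneous 3) (hg : g.IsHomogeneous 3)
    (hvf : ∀ i, eval (P i) f = 0) (hvg : ∀ i, eval (P i) g = 0)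
    (hind : ∀ a b : ℝ, C a * f + C b * g = 0 → a = 0 ∧ b = 0) :
    {t : ℝ | ∃ u : Fin 3 → ℂ, u ≠ 0 ∧ eval u (mC (f + C t * g)) = 0 ∧
      ∀ i, eval u (pderiv i (mC (f + C t * g))) = 0}.Finite := by
  have hne : ∀ t : ℝ, f + C t * g ≠ 0 := by
    intro t h0
    have := hind 1 t (by simpa using h0)
    exact one_ne_zero this.1
  have hh : ∀ t : ℝ, (f + C t * g).IsHomogeneous 3 := fun t => hf.add (hg.C_mul t)
  have hv : ∀ (t : ℝ) i, eval (P i) (f + C t * g) = 0 := fun t i => by simp [hvf, hvg]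
  have hE1 : {t : ℝ | ∃ i j, i ≠ j ∧ ∀ x y : ℝ, eval (x • P i + y • P j) (f + C t * g) = 0}.Finite := by
    have : {t : ℝ | ∃ i j, i ≠ j ∧ ∀ x y : ℝ, eval (x • P i + y • P j) (f + C t * g) = 0} =
        ⋃ i, ⋃ j, {t : ℝ | i ≠ j ∧ ∀ x y : ℝ, eval (x • P i + y • P j) (f + C t * g) = 0} := by
      ext t; simp only [Set.mem_ofPred_eq, Set.mem_iUnion]
    rw [this]
    refine Set.finite_iUnion fun i => Set.finite_iUnion fun j => Set.Subsingleton.finite ?_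
    rintro t ⟨hij, ht⟩ s ⟨-, hs⟩
    obtain ⟨c, hc⟩ := line_pair hP (hh t) (hh s) (hv t) (hv s) (hne t) (hP.ind i j hij) ht hs
    have h1 := hind (1 - c) (s - c * t) (by
      simp only [C_sub, C_mul, C_1]
      linear_combination hc)
    have h2 : c = 1 := by linarith [h1.1]
    have h3 := h1.2
    rw [h2] at h3
    linarith
  have hE2 : {t : ℝ | ∃ i, ∀ k, eval (P i) (pderiv k (f + C t * g)) = 0}.Finite := by
    have : {t : ℝ | ∃ i, ∀ k, eval (P i) (pderiv k (f + C t * g)) = 0} =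
        ⋃ i, {t : ℝ | ∀ k, eval (P i) (pderiv k (f + C t * g)) = 0} := by
      ext t; simp only [Set.mem_ofPred_eq, Set.mem_iUnion]
    rw [this]
    refine Set.finite_iUnion fun i => Set.Subsingleton.finite ?_
    intro t ht s hs
    by_contra hts
    have hg0 : ∀ k, eval (P i) (pderiv k g) = 0 := by
      intro k
      have h1 := ht k
      have h2 := hs k
      simp at h1 h2
      have h3 : (t - s) * eval (P i) (pderiv k g) = 0 := by linear_combination h1 - h2
      exact (mul_eq_zero.1 h3).resolve_left (sub_ne_zero.2 hts)
    refine sing_two hP hf hg hvf hvg hind i (fun k => ?_) hg0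
    have h1 := ht k
    simpa [hg0] using h1
  have hE3 := (bertini (mC f) (mC g)).preimage (f := fun t : ℝ => (t : ℂ))
    (fun a _ b _ hab => Complex.ofReal_injective hab)
  refine ((hE1.union hE2).union hE3).subset ?_
  rintro t ⟨u, hu, h0, hs⟩
  by_contra hnot
  simp only [Set.mem_union, not_or] at hnot
  obtain ⟨⟨n1, n2⟩, n3⟩ := hnot
  have hmap : mC (f + C t * g) = mC f + C (t : ℂ) * mC g := by
    simp [mC]
  have hgu : eval u (mC g) = 0 := by
    by_contra hgu
    apply n3
    refine ⟨u, ?_, ?_, hgu⟩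
    · rw [← hmap]; exact h0
    · rw [← hmap]; exact hs
  have hs' : ∀ k, eval u (mC (pderiv k (f + C t * g))) = 0 := fun k => by
    rw [← hs k, mC, pderiv_map]
  have hnl : ∀ a b, cr a b ≠ 0 → ∃ x y : ℝ, eval (x • a + y • b) (f + C t * g) ≠ 0 := by
    intro a b hab
    by_contra! hl
    exact n1 (on_line hP (hh t) (hv t) (hne t) hab hl)
  by_cases hreal : cr (fun i => (u i).re) (fun i => (u i).im) = 0
  · obtain ⟨v, ζ, hv0, hζ, huv⟩ := realpt hu hreal
    rw [huv, smul_C (hh t), eval_real] at h0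
    rw [huv, smul_C hg, eval_real] at hgu
    have k0 : eval v (f + C t * g) = 0 := by
      have := (mul_eq_zero.1 h0).resolve_left (pow_ne_zero _ hζ)
      exact_mod_cast this
    have kg : eval v g = 0 := by
      have := (mul_eq_zero.1 hgu).resolve_left (pow_ne_zero _ hζ)
      exact_mod_cast this
    have ks : ∀ k, eval v (pderiv k (f + C t * g)) = 0 := by
      intro k
      have h1 := hs' k
      rw [huv, smul_C' (hh t), eval_real] at h1
      have := (mul_eq_zero.1 h1).resolve_left (pow_ne_zero _ hζ)
      exact_mod_cast this
    refine realsing hP.ind (hh t) hg (hv t) hvg ?_ k0 ks kg ?_ hnl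
    · rintro ⟨e, he⟩
      have h1 := hind (-e) (1 - e * t) (by
        simp only [C_sub, C_mul, C_1, C_neg]
        linear_combination he)
      have h2 : e = 0 := by linarith [h1.1]
      have h3 := h1.2
      rw [h2] at h3
      norm_num at h3
    · intro i hi
      obtain ⟨s, hsi⟩ := cr_zero hi hv0
      apply n2
      refine ⟨i, fun k => ?_⟩
      rw [hsi, smul_R' (hh t), ks, mul_zero]
  · obtain ⟨x, y, hxy⟩ := hnl _ _ hreal
    exact hxy (nonreal (hh t) h0 hs' x y)

/-- `cub` as a linear map. -/
def cubL : (Fin 10 → ℝ) →ₗ[ℝ] MvPolynomial (Fin 3) ℝ where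
  toFun := cub
  map_add' a b := by simp [cub]; ring
  map_smul' r a := by simp [cub, smul_eq_C_mul]; ring

lemma cub_hom (c : Fin 10 → ℝ) : (cub c).IsHomogeneous 3 := by
  have m : ∀ i j k : Fin 3, ((X i * X j * X k : MvPolynomial (Fin 3) ℝ)).IsHomogeneous 3 :=
    fun i j k => ((isHomogeneous_X ℝ i).mul (isHomogeneous_X ℝ j)).mul (isHomogeneous_X ℝ k)
  have e : cub c = C (c 0) * (X 0 * X 0 * X 0) + C (c 1) * (X 0 * X 0 * X 1)
      + C (c 2) * (X 0 * X 0 * X 2) + C (c 3) * (X 0 * X 1 * X 1) + C (c 4) * (X 0 * X 1 * X 2)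
      + C (c 5) * (X 0 * X 2 * X 2) + C (c 6) * (X 1 * X 1 * X 1) + C (c 7) * (X 1 * X 1 * X 2)
      + C (c 8) * (X 1 * X 2 * X 2) + C (c 9) * (X 2 * X 2 * X 2) := by
    simp only [cub]; ring
  rw [e]
  exact (((((((((((m _ _ _).C_mul _).add ((m _ _ _).C_mul _)).add ((m _ _ _).C_mul _)).add
    ((m _ _ _).C_mul _)).add ((m _ _ _).C_mul _)).add ((m _ _ _).C_mul _)).add
    ((m _ _ _).C_mul _)).add ((m _ _ _).C_mul _)).add ((m _ _ _).C_mul _)).add ((m _ _ _).C_mul _))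

lemma cub_inj (c : Fin 10 → ℝ) (h : cub c = 0) : c = 0 := by
  have ev : ∀ x y z : ℝ, c 0 * x ^ 3 + c 1 * (x ^ 2 * y) + c 2 * (x ^ 2 * z)
      + c 3 * (x * y ^ 2) + c 4 * (x * y * z) + c 5 * (x * z ^ 2)
      + c 6 * y ^ 3 + c 7 * (y ^ 2 * z) + c 8 * (y * z ^ 2) + c 9 * z ^ 3 = 0 := by
    intro x y z
    have := congrArg (eval ![x, y, z]) h
    simpa [cub] using this
  have e1 := ev 1 0 0
  have e2 := ev 0 1 0
  have e3 := ev 0 0 1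
  have e4 := ev 1 1 0
  have e5 := ev 1 (-1) 0
  have e6 := ev 1 0 1
  have e7 := ev 1 0 (-1)
  have e8 := ev 0 1 1
  have e9 := ev 0 1 (-1)
  have e10 := ev 1 1 1
  norm_num at e1 e2 e3 e4 e5 e6 e7 e8 e9 e10
  funext i
  fin_cases i <;> simp <;> linarith

lemma fin_dim (V : Submodule ℝ (MvPolynomial (Fin 3) ℝ)) (hV : ∀ p ∈ V, p.IsHomogeneous 3) :
    FiniteDimensional ℝ V := by
  have : V ≤ LinearMap.range cubL := by
    intro p hp
    obtain ⟨c, rfl⟩ := coefs3 (hV p hp)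
    exact ⟨c, rfl⟩
  exact Submodule.finiteDimensional_of_le this

lemma lower {P : Fin 8 → Fin 3 → ℝ} (V : Submodule ℝ (MvPolynomial (Fin 3) ℝ))
    [FiniteDimensional ℝ V]
    (hV : ∀ p, p ∈ V ↔ p.IsHomogeneous 3 ∧ ∀ i, eval (P i) p = 0) : 2 ≤ Module.finrank ℝ V := by
  let Φ : (Fin 10 → ℝ) →ₗ[ℝ] (Fin 8 → ℝ) := (LinearMap.pi fun i => evL (P i)).comp cubL
  have h1 := LinearMap.finrank_range_add_finrank_ker Φ
  have h2 := Submodule.finrank_le (LinearMap.range Φ)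
  simp only [Module.finrank_fin_fun] at h1 h2
  let Ψ : LinearMap.ker Φ →ₗ[ℝ] V := (cubL.comp (LinearMap.ker Φ).subtype).codRestrict V (by
    rintro ⟨c, hc⟩
    rw [hV]
    refine ⟨cub_hom c, fun i => ?_⟩
    rw [← evL_apply]
    exact congrFun hc i)
  have h3 : Module.finrank ℝ (LinearMap.ker Φ) ≤ Module.finrank ℝ V := by
    refine LinearMap.finrank_le_finrank_of_injective (f := Ψ) ?_
    rw [injective_iff_map_eq_zero]
    rintro ⟨c, hc⟩ h
    have : cub c = 0 := congrArg Subtype.val h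
    exact Subtype.ext (cub_inj c this)
  omega

lemma exists_conf (T : Set P2) (hT8 : T.encard = 8) (hgen : GenPos T) :
    ∃ P : Fin 8 → Fin 3 → ℝ, Conf P ∧
      ∀ p, p ∈ Isub 3 T ↔ p.IsHomogeneous 3 ∧ ∀ i, eval (P i) p = 0 := by
  have hcard : Nat.card T = 8 := by
    rw [Nat.card_coe_set_eq, Set.ncard, hT8]; rfl
  have : Finite T := Nat.finite_of_card_ne_zero (by omega)
  let e : T ≃ Fin 8 := Finite.equivFinOfCardEq hcard
  have hcount : ∀ (p : MvPolynomial (Fin 3) ℝ) (N : ℕ), {P ∈ T | VanishAt p P}.encard ≤ N →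
      (Finset.univ.filter (fun i => eval ((e.symm i).1.rep) p = 0)).card ≤ N := by
    intro p N hN
    have hinj : Function.Injective (fun i => (e.symm i).1) :=
      Subtype.val_injective.comp e.symm.injective
    classical
    rw [← Finset.card_image_of_injective _ hinj]
    have h1 : ((Finset.image (fun i => (e.symm i).1)
        (Finset.univ.filter (fun i => eval ((e.symm i).1.rep) p = 0)) : Finset P2) : Set P2) ⊆
        {P ∈ T | VanishAt p P} := by
      intro Q hQ
      simp only [Finset.coe_image, Set.mem_image, Finset.coe_filter, Finset.mem_univ, true_and,
        Set.mem_ofPred_eq] at hQ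
      obtain ⟨i, hi, rfl⟩ := hQ
      exact ⟨(e.symm i).2, hi⟩
    have h2 := (Set.encard_le_encard h1).trans hN
    rw [Set.encard_coe_eq_coe_finsetCard] at h2
    exact_mod_cast h2
  refine ⟨fun i => (e.symm i).1.rep, ⟨?_, ?_, ?_⟩, ?_⟩
  · intro i j hij h0
    obtain ⟨s, hs⟩ := cr_zero h0 (Projectivization.rep_nonzero _)
    apply hij
    apply e.symm.injective
    apply Subtype.ext
    rw [← Projectivization.mk_rep (e.symm i).1, ← Projectivization.mk_rep (e.symm j).1]
    symm
    rw [Projectivization.mk_eq_mk_iff']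
    exact ⟨s, hs.symm⟩
  · intro n hn
    exact hcount _ 3 (hgen.1 _ (lin_ne hn) (lin_hom n))
  · intro c hc hc2
    exact hcount _ 6 (hgen.2 c hc hc2)
  · intro p
    simp only [Isub, Submodule.mem_inf, mem_homogeneousSubmodule]
    refine and_congr_right fun _ => ⟨fun h i => h _ (e.symm i).2, fun h Q hQ => ?_⟩
    have := h (e ⟨Q, hQ⟩)
    simpa [VanishAt] using this

theorem statement2 (T : Set P2) (hT8 : T.encard = 8) (hgen : GenPos T) :
    Module.finrank ℝ (Isub 3 T) = 2 ∧
    {L : Submodule ℝ (MvPolynomial (Fin 3) ℝ) |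
      ∃ h : MvPolynomial (Fin 3) ℝ, h ≠ 0 ∧ h ∈ Isub 3 T ∧
        (∃ u : Fin 3 → ℂ, u ≠ 0 ∧
          eval u (MvPolynomial.map (algebraMap ℝ ℂ) h) = 0 ∧
          ∀ i, eval u (pderiv i (MvPolynomial.map (algebraMap ℝ ℂ) h)) = 0) ∧
        L = Submodule.span ℝ {h}}.Finite := by
  obtain ⟨P, hP, hV⟩ := exists_conf T hT8 hgen
  have hfd : FiniteDimensional ℝ (Isub 3 T) := fin_dim _ fun p hp => ((hV p).1 hp).1
  have hrank : Module.finrank ℝ (Isub 3 T) = 2 := le_antisymm (upper hP _ hV) (lower _ hV)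
  refine ⟨hrank, ?_⟩
  let b := Module.finBasisOfFinrankEq ℝ (Isub 3 T) hrank
  obtain ⟨hf, hvf⟩ := (hV _).1 (b 0).2
  obtain ⟨hg, hvg⟩ := (hV _).1 (b 1).2
  have hspan : ∀ h ∈ Isub 3 T, ∃ x y : ℝ, h = C x * (b 0).1 + C y * (b 1).1 := by
    intro h hh
    have h1 := congrArg Subtype.val (b.sum_repr ⟨h, hh⟩)
    rw [Fin.sum_univ_two] at h1
    refine ⟨b.repr ⟨h, hh⟩ 0, b.repr ⟨h, hh⟩ 1, ?_⟩
    rw [C_mul', C_mul']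
    exact h1.symm
  have hind : ∀ x y : ℝ, C x * (b 0).1 + C y * (b 1).1 = 0 → x = 0 ∧ y = 0 := by
    intro x y h
    have h1 := Fintype.linearIndependent_iff.1 b.linearIndependent ![x, y] (by
      rw [Fin.sum_univ_two]
      apply Subtype.ext
      simpa [smul_eq_C_mul] using h)
    exact ⟨h1 0, h1 1⟩
  generalize (b 0).1 = f at *
  generalize (b 1).1 = g at *
  have hfin := pencil_finite hP hf hg hvf hvg hind
  refine ((hfin.image fun t => Submodule.span ℝ {f + C t * g}).union
    (Set.finite_singleton (Submodule.span ℝ {g}))).subset ?_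
  rintro L ⟨h, hne, hmem, ⟨u, hu, h0, hs⟩, rfl⟩
  obtain ⟨x, y, rfl⟩ := hspan h hmem
  by_cases hx : x = 0
  · right
    subst hx
    have hy : y ≠ 0 := by rintro rfl; simp at hne
    rw [Set.mem_singleton_iff]
    simp only [C_0, zero_mul, zero_add, C_mul']
    exact Submodule.span_singleton_smul_eq (IsUnit.mk0 y hy) g
  · left
    have e1 : C x * f + C y * g = C x * (f + C (y / x) * g) := by
      rw [mul_add, ← mul_assoc, ← C_mul, mul_div_cancel₀ _ hx]
    rw [e1] at h0 hs ⊢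
    refine ⟨y / x, ⟨u, hu, ?_, fun i => ?_⟩, ?_⟩
    · rw [map_mul, map_C, map_mul, eval_C] at h0
      exact (mul_eq_zero.1 h0).resolve_left (by simpa using hx)
    · have := hs i
      rw [map_mul, map_C, pderiv_C_mul, map_mul, eval_C] at this
      exact (mul_eq_zero.1 this).resolve_left (by simpa using hx)
    · simp only [C_mul' (a := x)]
      exact (Submodule.span_singleton_smul_eq (IsUnit.mk0 x hx) _).symm

end
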